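/- arXiv:1806.04343 — 2 statements merged into one kernel-verified Lean document; each statement's English description precedes it below -/
import Mathlib

section
/- For every λ > 0, every maximizer q* of q ↦ 𝓕(λ,q) over [0,∞) satisfies q* ≤ E_{P0}[X²] and the fixed-point equation q* = 2·ψ′_{P0}(λ·q*). -/
/-!
For every `λ > 0`, every maximizer `q*` of `q ↦ 𝓕(λ, q)` over `[0, ∞)` satisfies
`q* ≤ E_{P0}[X²]` and the fixed-point equation `q* = 2 ψ′_{P0}(λ q*)`.
-/

open MeasureTheory ProbabilityTheory Filter Finset Real

noncomputable section

/-- The standard Gaussian measure on `ℝ`. -/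
def stdGauss : Measure ℝ := gaussianReal 0 1

/-- The scalar free energy
`ψ_{P0}(γ) = E[log ∫ exp(√γ Z x + γ x X − (γ/2) x²) dP0(x)]`. -/
def scalarFE (P0 : Measure ℝ) (γ : ℝ) : ℝ :=
  ∫ x0, (∫ z,
      Real.log (∫ x,
        Real.exp (Real.sqrt γ * z * x + γ * x * x0 - γ / 2 * x ^ 2) ∂P0)
    ∂stdGauss) ∂P0

/-- The Replica-Symmetric potential `𝓕(λ, q) = ψ_{P0}(λ q) − (λ/4) q²`. -/
def RSpot (P0 : Measure ℝ) (lam q : ℝ) : ℝ :=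
  scalarFE P0 (lam * q) - lam / 4 * q ^ 2

/-- `q` is a maximizer of `q ↦ 𝓕(λ, q)` over `[0, ∞)`. -/
def Maximizes (P0 : Measure ℝ) (lam q : ℝ) : Prop :=
  0 ≤ q ∧ ∀ q' ≥ (0 : ℝ), RSpot P0 lam q' ≤ RSpot P0 lam q

open scoped NNReal ENNReal

/-- The density at `u` of the law `N(s * x, s)` with respect to `N(0, s)`. -/
def gaussLR (s u x : ℝ) : ℝ := Real.exp (x * u - s * x ^ 2 / 2)

/-- The density at `u` of the `P0`-mixture of the laws `N(s * x, s)` with respect to `N(0, s)`. -/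
def evidence (P0 : Measure ℝ) (s u : ℝ) : ℝ := ∫ x, gaussLR s u x ∂P0

@[fun_prop]
lemma measurable_gaussLR {α : Type*} [MeasurableSpace α] {f g : α → ℝ} (s : ℝ)
    (hf : Measurable f) (hg : Measurable g) : Measurable fun a => gaussLR s (f a) (g a) := by
  unfold gaussLR; fun_prop

lemma gaussLR_pos (s u x : ℝ) : 0 < gaussLR s u x := Real.exp_pos _

lemma gaussLR_add (s t u v x : ℝ) :
    gaussLR (s + t) (u + v) x = gaussLR s u x * gaussLR t v x := by
  simp only [gaussLR, ← Real.exp_add]; ring_nf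

lemma gaussLR_le {s : ℝ} (hs : 0 < s) (u x : ℝ) :
    gaussLR s u x ≤ Real.exp (u ^ 2 / (2 * s)) := by
  refine Real.exp_le_exp.2 ?_
  rw [le_div_iff₀ (by positivity)]
  nlinarith [sq_nonneg (s * x - u)]

section evidence

variable {P0 : Measure ℝ} [IsProbabilityMeasure P0] {s : ℝ}

lemma integrable_gaussLR (hs : 0 < s) (u : ℝ) : Integrable (gaussLR s u) P0 := by
  refine Integrable.of_bound (C := Real.exp (u ^ 2 / (2 * s)))
    (measurable_gaussLR s measurable_const measurable_id).aestronglyMeasurable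
    (ae_of_all _ fun x => ?_)
  rw [Real.norm_eq_abs, abs_of_pos (gaussLR_pos _ _ _)]
  exact gaussLR_le hs u x

lemma ofReal_evidence (hs : 0 < s) (u : ℝ) :
    ENNReal.ofReal (evidence P0 s u) = ∫⁻ x, ENNReal.ofReal (gaussLR s u x) ∂P0 :=
  ofReal_integral_eq_lintegral_ofReal (integrable_gaussLR hs u)
    (ae_of_all _ fun x => (gaussLR_pos s u x).le)

lemma evidence_pos (hs : 0 < s) (u : ℝ) : 0 < evidence P0 s u :=
  integral_exp_pos (integrable_gaussLR hs u)

lemma log_evidence_le (hs : 0 < s) (u : ℝ) :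
    Real.log (evidence P0 s u) ≤ u ^ 2 / (2 * s) := by
  rw [Real.log_le_iff_le_exp (evidence_pos hs u)]
  calc evidence P0 s u ≤ ∫ _, Real.exp (u ^ 2 / (2 * s)) ∂P0 :=
        integral_mono (integrable_gaussLR hs u) (integrable_const _) fun x => gaussLR_le hs u x
    _ = _ := by simp

lemma integrable_id_of_sq (hmom : Integrable (fun x => x ^ 2) P0) :
    Integrable (fun x : ℝ => x) P0 :=
  ((memLp_two_iff_integrable_sq aestronglyMeasurable_id).2 hmom).integrable (by norm_num)

lemma le_log_evidence (hmom : Integrable (fun x => x ^ 2) P0) (hs : 0 < s) (u : ℝ) :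
    (∫ x, x ∂P0) * u - s * (∫ x, x ^ 2 ∂P0) / 2 ≤ Real.log (evidence P0 s u) := by
  rw [Real.le_log_iff_exp_le (evidence_pos hs u)]
  set c := (∫ x, x ∂P0) * u - s * (∫ x, x ^ 2 ∂P0) / 2 with hc
  have h1 : Integrable (fun x : ℝ => x * u) P0 := (integrable_id_of_sq hmom).mul_const u
  have h2 : Integrable (fun x : ℝ => s * x ^ 2 / 2) P0 := (hmom.const_mul s).div_const 2
  have hI : ∫ x, (x * u - s * x ^ 2 / 2) ∂P0 = c := by
    rw [integral_sub h1 h2, integral_mul_const, integral_div, integral_const_mul]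
  have h3 : ∫ x, (Real.exp c * (x * u - s * x ^ 2 / 2 - c + 1)) ∂P0 = Real.exp c := by
    have h4 : Integrable (fun x : ℝ => x * u - s * x ^ 2 / 2) P0 := h1.sub h2
    have h5 : Integrable (fun x : ℝ => x * u - s * x ^ 2 / 2 - c) P0 :=
      h4.sub (integrable_const _)
    rw [integral_const_mul, integral_add h5 (integrable_const _),
      integral_sub h4 (integrable_const _), hI]
    simp
  rw [← h3]
  refine integral_mono ((((h1.sub h2).sub (integrable_const _)).add
    (integrable_const _)).const_mul _) (integrable_gaussLR hs u) fun x => ?_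
  calc Real.exp c * (x * u - s * x ^ 2 / 2 - c + 1)
      ≤ Real.exp c * Real.exp (x * u - s * x ^ 2 / 2 - c) := by
        gcongr; exact Real.add_one_le_exp _
    _ = gaussLR s u x := by rw [← Real.exp_add, gaussLR]; ring_nf

lemma measurable_evidence (P0 : Measure ℝ) [IsProbabilityMeasure P0] (s : ℝ) :
    Measurable (evidence P0 s) := by
  refine (StronglyMeasurable.integral_prod_right (f := fun u x => gaussLR s u x) ?_).measurable
  exact (measurable_gaussLR s measurable_fst measurable_snd).stronglyMeasurable

end evidence

section tilt

lemma measurePreserving_shift_gaussianReal {s : ℝ≥0} (hs : 0 < s) (x : ℝ) :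
    MeasurePreserving (fun a => s * x + a) (gaussianReal 0 s)
      ((gaussianReal 0 s).withDensity fun a => ENNReal.ofReal (gaussLR s a x)) := by
  refine ⟨by fun_prop, ?_⟩
  have hm : Measurable fun a => ENNReal.ofReal (gaussLR s a x) := by fun_prop
  rw [gaussianReal_map_const_add, gaussianReal_of_var_ne_zero _ hs.ne',
    gaussianReal_of_var_ne_zero _ hs.ne', ← withDensity_mul _ (measurable_gaussianPDF _ _) hm]
  congr 1
  ext a
  simp only [gaussianPDF, Pi.mul_apply]
  rw [← ENNReal.ofReal_mul (gaussianPDFReal_nonneg _ _ _)]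
  congr 1
  have : (s : ℝ) ≠ 0 := by exact_mod_cast hs.ne'
  simp only [gaussianPDFReal, gaussLR]
  rw [mul_assoc _ (Real.exp _), ← Real.exp_add]
  congr 2
  field_simp
  ring

lemma measurePreserving_prodMap_withDensity {α β : Type*} [MeasurableSpace α] [MeasurableSpace β]
    {μ : Measure α} {ν : Measure β} [SFinite μ] [SFinite ν] {f : α → α} {g : β → β}
    {D : α → ℝ≥0∞} {E : β → ℝ≥0∞} (hD : Measurable D) (hE : Measurable E)
    (hf : MeasurePreserving f μ (μ.withDensity D))
    (hg : MeasurePreserving g ν (ν.withDensity E)) :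
    MeasurePreserving (Prod.map f g) (μ.prod ν)
      ((μ.prod ν).withDensity fun p => D p.1 * E p.2) := by
  rw [← MeasureTheory.prod_withDensity hD hE]
  exact hf.prod hg

lemma lintegral_comp_tilt {α : Type*} [MeasurableSpace α] {P0 : Measure ℝ}
    [IsProbabilityMeasure P0] {μ : Measure α} [SFinite μ] {τ : ℝ → α → α} {D : ℝ → α → ℝ≥0∞}
    (hτ : Measurable (Function.uncurry τ)) (hD : Measurable (Function.uncurry D))
    (h : ∀ x, MeasurePreserving (τ x) μ (μ.withDensity (D x))) {f : α → ℝ≥0∞}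
    (hf : Measurable f) :
    ∫⁻ p, f (τ p.1 p.2) ∂(P0.prod μ) = ∫⁻ a, (∫⁻ x, D x a ∂P0) * f a ∂μ := by
  have hfτ : Measurable fun p : ℝ × α => f (τ p.1 p.2) := hf.comp hτ
  rw [lintegral_prod _ hfτ.aemeasurable]
  have hx (x : ℝ) : ∫⁻ a, f (τ x a) ∂μ = ∫⁻ a, D x a * f a ∂μ := by
    rw [(h x).lintegral_comp hf, lintegral_withDensity_eq_lintegral_mul _ (by fun_prop) hf]
    rfl
  simp_rw [hx]
  rw [lintegral_lintegral_swap
    (hD.mul (hf.comp measurable_snd)).aemeasurable]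
  exact lintegral_congr fun a => lintegral_mul_const _ (by fun_prop)

end tilt

section gaussian

variable {P0 : Measure ℝ} [IsProbabilityMeasure P0] {s t : ℝ≥0}

lemma lintegral_gaussLR (ht : 0 < t) (x : ℝ) :
    ∫⁻ b, ENNReal.ofReal (gaussLR t b x) ∂gaussianReal 0 t = 1 := by
  have h := (measurePreserving_shift_gaussianReal ht x).lintegral_comp
    (f := fun _ => 1) measurable_const
  simpa using h.symm

lemma lintegral_evidence (hs : 0 < s) :
    ∫⁻ u, ENNReal.ofReal (evidence P0 s u) ∂gaussianReal 0 s = 1 := by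
  simp_rw [ofReal_evidence (P0 := P0) (NNReal.coe_pos.2 hs)]
  rw [lintegral_lintegral_swap (by fun_prop)]
  simp [lintegral_gaussLR hs]

lemma lintegral_evidence_add (hs : 0 < s) (ht : 0 < t) (a : ℝ) :
    ∫⁻ b, ENNReal.ofReal (evidence P0 (s + t) (a + b)) ∂gaussianReal 0 t
      = ENNReal.ofReal (evidence P0 s a) := by
  have hs' : (0 : ℝ) < s := hs
  have ht' : (0 : ℝ) < t := ht
  simp_rw [ofReal_evidence (P0 := P0) hs', ofReal_evidence (P0 := P0) (add_pos hs' ht'),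
    gaussLR_add, ENNReal.ofReal_mul (gaussLR_pos _ _ _).le]
  rw [lintegral_lintegral_swap (by fun_prop)]
  refine lintegral_congr fun x => ?_
  rw [lintegral_const_mul _ (by fun_prop), lintegral_gaussLR ht, mul_one]

lemma measurePreserving_add_gaussianReal (s t : ℝ≥0) :
    MeasurePreserving (fun p : ℝ × ℝ => p.1 + p.2)
      ((gaussianReal 0 s).prod (gaussianReal 0 t)) (gaussianReal 0 (s + t)) := by
  refine ⟨by fun_prop, ?_⟩
  have h := gaussianReal_conv_gaussianReal (m₁ := 0) (m₂ := 0) (v₁ := s) (v₂ := t)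
  rwa [add_zero] at h

/-- The logarithm of the evidence at the observation `s * x + a`. -/
def logEv (P0 : Measure ℝ) (s : ℝ) (p : ℝ × ℝ) : ℝ := Real.log (evidence P0 s (s * p.1 + p.2))

lemma measurable_logEv (s : ℝ) : Measurable (logEv P0 s) :=
  Real.measurable_log.comp ((measurable_evidence P0 s).comp (by fun_prop))

lemma integrable_sq_gaussianReal (s : ℝ≥0) : Integrable (fun a => a ^ 2) (gaussianReal 0 s) :=
  (memLp_id_gaussianReal (μ := 0) (v := s) 2).integrable_sq

lemma integral_sq_gaussianReal (s : ℝ≥0) : ∫ a, a ^ 2 ∂gaussianReal 0 s = s := by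
  have h := variance_eq_sub (memLp_id_gaussianReal (μ := 0) (v := s) 2)
  simpa [integral_id_gaussianReal] using h.symm

lemma integrable_observation_sq (hmom : Integrable (fun x => x ^ 2) P0) (s : ℝ≥0) :
    Integrable (fun p : ℝ × ℝ => (s * p.1 + p.2) ^ 2) (P0.prod (gaussianReal 0 s)) := by
  have h1 : Integrable (fun p : ℝ × ℝ => p.1 ^ 2) (P0.prod (gaussianReal 0 s)) :=
    hmom.comp_fst _
  have h2 : Integrable (fun p : ℝ × ℝ => p.2 ^ 2) (P0.prod (gaussianReal 0 s)) :=
    (integrable_sq_gaussianReal s).comp_snd _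
  refine ((h1.const_mul (2 * (s : ℝ) ^ 2)).add (h2.const_mul 2)).mono' (by fun_prop)
    (ae_of_all _ fun p => ?_)
  rw [Real.norm_eq_abs, abs_of_nonneg (sq_nonneg _), Pi.add_apply]
  nlinarith [sq_nonneg (s * p.1 - p.2)]

lemma integral_observation_sq (hmom : Integrable (fun x => x ^ 2) P0) (s : ℝ≥0) :
    ∫ p, (s * p.1 + p.2) ^ 2 ∂(P0.prod (gaussianReal 0 s)) = s ^ 2 * (∫ x, x ^ 2 ∂P0) + s := by
  rw [integral_prod _ (integrable_observation_sq hmom s)]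
  have h (x : ℝ) : ∫ a, (s * x + a) ^ 2 ∂gaussianReal 0 s = s ^ 2 * x ^ 2 + s := by
    have h1 : Integrable (fun a => 2 * (s * x) * a) (gaussianReal 0 s) :=
      (integrable_id_of_sq (integrable_sq_gaussianReal s)).const_mul _
    have h2 : Integrable (fun a => (s * x) ^ 2 + 2 * (s * x) * a) (gaussianReal 0 s) :=
      (integrable_const _).add h1
    simp_rw [add_sq]
    rw [integral_add h2 (integrable_sq_gaussianReal s),
      integral_add (integrable_const _) h1, integral_const_mul, integral_id_gaussianReal,
      integral_sq_gaussianReal]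
    simp [mul_pow]
  simp_rw [h]
  rw [integral_add (hmom.const_mul _) (integrable_const _), integral_const_mul]
  simp

lemma integrable_logEv (hmom : Integrable (fun x => x ^ 2) P0) (hs : 0 < s) :
    Integrable (logEv P0 s) (P0.prod (gaussianReal 0 s)) := by
  have hs' : (0 : ℝ) < s := hs
  have hsq := integrable_observation_sq hmom s
  set m := ∫ x, x ∂P0
  set M := ∫ x, x ^ 2 ∂P0
  have hM : 0 ≤ M := integral_nonneg fun x => sq_nonneg x
  refine ((hsq.div_const (2 * s)).add ((hsq.div_const 2).add
    (integrable_const (m ^ 2 / 2 + s * M / 2)))).mono'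
    (measurable_logEv _).aestronglyMeasurable (ae_of_all _ fun p => ?_)
  have h1 := log_evidence_le (P0 := P0) hs' (s * p.1 + p.2)
  have h2 := le_log_evidence hmom hs' (s * p.1 + p.2)
  have h3 : 0 ≤ (s * p.1 + p.2) ^ 2 / (2 * s) := by positivity
  have h4 : 0 ≤ s * M / 2 := by positivity
  simp only [Real.norm_eq_abs, Pi.add_apply, logEv]
  rw [abs_le]
  constructor <;> nlinarith [sq_nonneg (m + (s * p.1 + p.2)), sq_nonneg m,
    sq_nonneg (s * p.1 + p.2)]

lemma scalarFE_eq_integral_logEv (hmom : Integrable (fun x => x ^ 2) P0) (hs : 0 < s) :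
    scalarFE P0 s = ∫ p, logEv P0 s p ∂(P0.prod (gaussianReal 0 s)) := by
  rw [integral_prod _ (integrable_logEv hmom hs)]
  have hmap : (stdGauss).map (fun z => Real.sqrt s * z) = gaussianReal 0 s := by
    rw [stdGauss, gaussianReal_map_const_mul, mul_zero, mul_one]
    congr 1
    ext
    simp
  refine integral_congr_ae (ae_of_all _ fun x0 => ?_)
  simp only
  have hm : Measurable fun a => logEv P0 s (x0, a) := (measurable_logEv _).comp (by fun_prop)
  rw [← hmap, integral_map (by fun_prop) hm.aestronglyMeasurable]
  refine integral_congr_ae (ae_of_all _ fun z => ?_)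
  simp only [logEv, evidence, gaussLR]
  congr 2
  ext x
  ring_nf

end gaussian

lemma integral_nonpos_of_lintegral_exp_le_one {α : Type*} [MeasurableSpace α] {μ : Measure α}
    [IsProbabilityMeasure μ] {k : α → ℝ} (hk : Integrable k μ)
    (h : ∫⁻ a, ENNReal.ofReal (Real.exp (k a)) ∂μ ≤ 1) : ∫ a, k a ∂μ ≤ 0 := by
  have hm : AEStronglyMeasurable (fun a => Real.exp (k a)) μ :=
    Real.continuous_exp.comp_aestronglyMeasurable hk.1
  have hpos : 0 ≤ᵐ[μ] fun a => Real.exp (k a) := ae_of_all _ fun a => (Real.exp_pos _).le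
  have hint : Integrable (fun a => Real.exp (k a)) μ :=
    ⟨hm, (hasFiniteIntegral_iff_ofReal hpos).2 (h.trans_lt ENNReal.one_lt_top)⟩
  have h1 : ∫ a, Real.exp (k a) ∂μ ≤ 1 := by
    rw [integral_eq_lintegral_of_nonneg_ae hpos hm]
    exact ENNReal.toReal_mono ENNReal.one_ne_top h
  have h2 : ∫ a, (k a + 1) ∂μ ≤ ∫ a, Real.exp (k a) ∂μ :=
    integral_mono (hk.add (integrable_const _)) hint fun a => Real.add_one_le_exp _
  rw [integral_add hk (integrable_const _)] at h2
  simp at h2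
  linarith

section freeEnergy

variable {P0 : Measure ℝ} [IsProbabilityMeasure P0] {s t : ℝ≥0}

lemma integrable_and_integral_logEv_comp {α : Type*} [MeasurableSpace α]
    {μ : Measure α} (hmom : Integrable (fun x => x ^ 2) P0) (hs : 0 < s) {φ : α → ℝ × ℝ}
    (hφ : MeasurePreserving φ μ (P0.prod (gaussianReal 0 s))) :
    Integrable (fun a => logEv P0 s (φ a)) μ ∧ ∫ a, logEv P0 s (φ a) ∂μ = scalarFE P0 s := by
  refine ⟨hφ.integrable_comp_of_integrable (integrable_logEv hmom hs), ?_⟩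
  rw [scalarFE_eq_integral_logEv hmom hs, ← hφ.map_eq,
    integral_map hφ.measurable.aemeasurable (measurable_logEv _).aestronglyMeasurable]

lemma scalarFE_le (hmom : Integrable (fun x => x ^ 2) P0) (hs : 0 < s) :
    scalarFE P0 s ≤ (s * (∫ x, x ^ 2 ∂P0) + 1) / 2 := by
  have hs' : (0 : ℝ) < s := hs
  have hsq := integrable_observation_sq hmom s
  rw [scalarFE_eq_integral_logEv hmom hs]
  calc ∫ p, logEv P0 s p ∂(P0.prod (gaussianReal 0 s))
      ≤ ∫ p, (s * p.1 + p.2) ^ 2 / (2 * s) ∂(P0.prod (gaussianReal 0 s)) :=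
        integral_mono (integrable_logEv hmom hs) (hsq.div_const _)
          fun p => log_evidence_le hs' _
    _ = _ := by
        rw [integral_div, integral_observation_sq hmom]
        field_simp

lemma scalarFE_nonneg (hmom : Integrable (fun x => x ^ 2) P0) (hs : 0 < s) :
    0 ≤ scalarFE P0 s := by
  have hs' : (0 : ℝ) < s := hs
  have hev := measurable_evidence P0 s
  have key : ∫ p, -logEv P0 s p ∂(P0.prod (gaussianReal 0 s)) ≤ 0 := by
    refine integral_nonpos_of_lintegral_exp_le_one (integrable_logEv hmom hs).neg ?_
    have h := lintegral_comp_tilt (P0 := P0) (μ := gaussianReal 0 s)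
      (τ := fun x a => s * x + a) (D := fun x a => ENNReal.ofReal (gaussLR s a x))
      (f := fun u => ENNReal.ofReal (evidence P0 s u)⁻¹)
      (by unfold Function.uncurry; fun_prop) (by unfold Function.uncurry; fun_prop)
      (measurePreserving_shift_gaussianReal hs) (by fun_prop)
    have he (p : ℝ × ℝ) : Real.exp (-logEv P0 s p) = (evidence P0 s (s * p.1 + p.2))⁻¹ := by
      rw [Real.exp_neg, logEv, Real.exp_log (evidence_pos hs' _)]
    simp_rw [he]
    refine h.le.trans ?_
    simp_rw [← ofReal_evidence (P0 := P0) hs', ← ENNReal.ofReal_mul (evidence_pos hs' _).le,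
      mul_inv_cancel₀ (evidence_pos (P0 := P0) hs' _).ne']
    simp
  rw [integral_neg] at key
  rw [scalarFE_eq_integral_logEv hmom hs]
  linarith

lemma lintegral_evidence_ratio_le_one (hs : 0 < s) (ht : 0 < t) :
    ∫⁻ r : ℝ × ℝ × ℝ, ENNReal.ofReal (evidence P0 (s + t) (r.1 + r.2.1) *
        evidence P0 (s + t) (r.1 + r.2.2) / evidence P0 s r.1)
      ∂((gaussianReal 0 s).prod ((gaussianReal 0 t).prod (gaussianReal 0 t))) = 1 := by
  have hs' : (0 : ℝ) < s := hs
  have hst : (0 : ℝ) < s + t := add_pos_of_pos_of_nonneg hs' t.2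
  have hev := measurable_evidence P0 s
  have hev' := measurable_evidence P0 (s + t)
  rw [lintegral_prod _ (by fun_prop), ← lintegral_evidence (P0 := P0) hs]
  refine lintegral_congr fun a => ?_
  have hpos := evidence_pos (P0 := P0) hs' a
  have hsplit (r : ℝ × ℝ) : ENNReal.ofReal (evidence P0 (s + t) (a + r.1) *
        evidence P0 (s + t) (a + r.2) / evidence P0 s a) =
      ENNReal.ofReal (evidence P0 s a)⁻¹ * (ENNReal.ofReal (evidence P0 (s + t) (a + r.1)) *
        ENNReal.ofReal (evidence P0 (s + t) (a + r.2))) := by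
    rw [← ENNReal.ofReal_mul (evidence_pos hst _).le, ← ENNReal.ofReal_mul (by positivity),
      div_eq_inv_mul]
  simp_rw [hsplit]
  rw [lintegral_const_mul _ (by fun_prop), lintegral_prod_mul
    (f := fun b => ENNReal.ofReal (evidence P0 (s + t) (a + b)))
    (g := fun b => ENNReal.ofReal (evidence P0 (s + t) (a + b))) (by fun_prop) (by fun_prop),
    lintegral_evidence_add hs ht, ← ENNReal.ofReal_mul hpos.le,
    ← ENNReal.ofReal_mul (by positivity), inv_mul_cancel_left₀ hpos.ne']

lemma lintegral_shifted_evidence_ratio_le_one (hs : 0 < s) (ht : 0 < t) :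
    ∫⁻ p : ℝ × ℝ × ℝ × ℝ, ENNReal.ofReal
        (evidence P0 (s + t) (s * p.1 + p.2.1 + (t * p.1 + p.2.2.1)) *
          evidence P0 (s + t) (s * p.1 + p.2.1 + (t * p.1 + p.2.2.2)) /
          (evidence P0 s (s * p.1 + p.2.1) * evidence P0 (s + (t + t))
            (s * p.1 + p.2.1 + (t * p.1 + p.2.2.1 + (t * p.1 + p.2.2.2)))))
      ∂(P0.prod ((gaussianReal 0 s).prod ((gaussianReal 0 t).prod (gaussianReal 0 t)))) ≤ 1 := by
  have hstt : (0 : ℝ) < s + (t + t) := by positivity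
  have hev := measurable_evidence P0 s
  have hev' := measurable_evidence P0 (s + t)
  have hev'' := measurable_evidence P0 (s + (t + t))
  let τ (x : ℝ) : ℝ × ℝ × ℝ → ℝ × ℝ × ℝ :=
    Prod.map (fun a => s * x + a) (Prod.map (fun a => t * x + a) (fun a => t * x + a))
  let D (x : ℝ) (r : ℝ × ℝ × ℝ) : ℝ≥0∞ := ENNReal.ofReal (gaussLR s r.1 x) *
    (ENNReal.ofReal (gaussLR t r.2.1 x) * ENNReal.ofReal (gaussLR t r.2.2 x))
  have hτ : Measurable (Function.uncurry τ) := by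
    unfold τ Function.uncurry Prod.map; fun_prop
  have hD : Measurable (Function.uncurry D) := by
    unfold D Function.uncurry; fun_prop
  have hm (c x : ℝ) : Measurable fun a => ENNReal.ofReal (gaussLR c a x) := by fun_prop
  have hT (x : ℝ) : MeasurePreserving (τ x)
      ((gaussianReal 0 s).prod ((gaussianReal 0 t).prod (gaussianReal 0 t)))
      (((gaussianReal 0 s).prod ((gaussianReal 0 t).prod (gaussianReal 0 t))).withDensity (D x)) := by
    have h2 := measurePreserving_prodMap_withDensity (hm t x) (hm t x)
      (measurePreserving_shift_gaussianReal ht x) (measurePreserving_shift_gaussianReal ht x)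
    have h3 := measurePreserving_prodMap_withDensity (hm s x)
      (((hm t x).comp measurable_fst).mul ((hm t x).comp measurable_snd))
      (measurePreserving_shift_gaussianReal hs x) h2
    exact h3
  have h := lintegral_comp_tilt (P0 := P0)
    (f := fun r => ENNReal.ofReal (evidence P0 (s + t) (r.1 + r.2.1) *
        evidence P0 (s + t) (r.1 + r.2.2) /
        (evidence P0 s r.1 * evidence P0 (s + (t + t)) (r.1 + (r.2.1 + r.2.2)))))
    hτ hD hT (by fun_prop)
  simp only [τ, D, Prod.map] at h
  rw [h, ← lintegral_evidence_ratio_le_one (P0 := P0) hs ht]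
  refine (lintegral_congr fun r => ?_).le
  have h3 := evidence_pos (P0 := P0) hstt (r.1 + (r.2.1 + r.2.2))
  simp_rw [← ENNReal.ofReal_mul (gaussLR_pos _ _ _).le, ← gaussLR_add]
  rw [← ofReal_evidence hstt, ← ENNReal.ofReal_mul h3.le]
  rw [← mul_div_assoc, mul_comm (evidence P0 s r.1), mul_div_mul_left _ _ h3.ne']

lemma two_mul_scalarFE_add_le (hmom : Integrable (fun x => x ^ 2) P0) (hs : 0 < s) (ht : 0 < t) :
    2 * scalarFE P0 (s + t) ≤ scalarFE P0 s + scalarFE P0 (s + (t + t)) := by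
  have hs' : (0 : ℝ) < s := hs
  have hst : (0 : ℝ) < s + t := add_pos_of_pos_of_nonneg hs' t.2
  have hstt : (0 : ℝ) < s + (t + t) := by positivity
  have hid := MeasurePreserving.id P0
  have hids := MeasurePreserving.id (gaussianReal 0 s)
  obtain ⟨i0, e0⟩ := integrable_and_integral_logEv_comp hmom hs (hid.prod
    (measurePreserving_fst (μ := gaussianReal 0 s)
      (ν := (gaussianReal 0 t).prod (gaussianReal 0 t))))
  obtain ⟨i1, e1⟩ := integrable_and_integral_logEv_comp hmom (add_pos hs ht)
    (hid.prod ((measurePreserving_add_gaussianReal s t).comp (hids.prod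
      (measurePreserving_fst (μ := gaussianReal 0 t) (ν := gaussianReal 0 t)))))
  obtain ⟨i2, e2⟩ := integrable_and_integral_logEv_comp hmom (add_pos hs ht)
    (hid.prod ((measurePreserving_add_gaussianReal s t).comp (hids.prod
      (measurePreserving_snd (μ := gaussianReal 0 t) (ν := gaussianReal 0 t)))))
  obtain ⟨i3, e3⟩ := integrable_and_integral_logEv_comp hmom (add_pos hs (add_pos ht ht))
    (hid.prod ((measurePreserving_add_gaussianReal s (t + t)).comp
      (hids.prod (measurePreserving_add_gaussianReal t t))))
  simp only [Prod.map, Function.comp, id, NNReal.coe_add] at i0 e0 i1 e1 i2 e2 i3 e3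
  have i12 := i1.add i2
  have i03 := i0.add i3
  have key := integral_nonpos_of_lintegral_exp_le_one (i12.sub i03) ?_
  · rw [integral_sub' i12 i03, integral_add' i1 i2, integral_add' i0 i3, e0, e1, e2, e3] at key
    linarith
  refine (lintegral_congr fun p => ?_).trans_le
    (lintegral_shifted_evidence_ratio_le_one (P0 := P0) hs ht)
  simp only [Pi.sub_apply, Pi.add_apply, Real.exp_sub, Real.exp_add, logEv]
  rw [Real.exp_log (evidence_pos hs' _), Real.exp_log (evidence_pos hst _),
    Real.exp_log (evidence_pos hst _), Real.exp_log (evidence_pos hstt _)]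
  ring_nf

lemma scalarFE_midpoint (hmom : Integrable (fun x => x ^ 2) P0) {g d : ℝ} (hg : 0 < g)
    (hd : 0 < d) : 2 * scalarFE P0 (g + d) ≤ scalarFE P0 g + scalarFE P0 (g + (d + d)) := by
  lift g to ℝ≥0 using hg.le
  lift d to ℝ≥0 using hd.le
  exact two_mul_scalarFE_add_le hmom hg hd

lemma scalarFE_add_le (hmom : Integrable (fun x => x ^ 2) P0) {g d : ℝ} (hg : 0 < g)
    (hd : 0 < d) : scalarFE P0 (g + d) ≤ scalarFE P0 g + d / 2 * ∫ x, x ^ 2 ∂P0 := by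
  set M := ∫ x, x ^ 2 ∂P0
  set Δ := scalarFE P0 (g + d) - scalarFE P0 g with hΔ
  have hstep (n : ℕ) : Δ ≤ scalarFE P0 (g + (n + 1) * d) - scalarFE P0 (g + n * d) := by
    induction n with
    | zero => simp [hΔ]
    | succ n ih =>
      have h := scalarFE_midpoint hmom (g := g + n * d) (by positivity) hd
      rw [show g + n * d + d = g + (n + 1) * d by ring,
        show g + n * d + (d + d) = g + (n + 1 + 1) * d by ring] at h
      push_cast
      linarith
  have hlin (n : ℕ) : n * Δ ≤ scalarFE P0 (g + n * d) - scalarFE P0 g := by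
    induction n with
    | zero => simp
    | succ n ih =>
      push_cast
      linarith [hstep n]
  have hbound (n : ℕ) : n * (Δ - d / 2 * M) ≤ (g * M + 1) / 2 - scalarFE P0 g := by
    have hpos : 0 < g + n * d := by positivity
    have h : scalarFE P0 (g + n * d) ≤ ((g + n * d) * M + 1) / 2 :=
      scalarFE_le hmom (s := ⟨g + n * d, hpos.le⟩) hpos
    nlinarith [hlin n]
  by_contra! hcon
  obtain ⟨n, hn⟩ := exists_nat_gt (((g * M + 1) / 2 - scalarFE P0 g) / (Δ - d / 2 * M))
  rw [div_lt_iff₀ (by linarith)] at hn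
  exact absurd (hbound n) (not_le.2 hn)

lemma scalarFE_zero (P0 : Measure ℝ) [IsProbabilityMeasure P0] : scalarFE P0 0 = 0 := by
  simp [scalarFE]

end freeEnergy

lemma isLittleO_sub_of_abs_le_sq {f : ℝ → ℝ} {x C : ℝ} {l : Filter ℝ} (hl : l ≤ nhds x)
    (h : ∀ᶠ y in l, |f y| ≤ C * (y - x) ^ 2) : f =o[l] fun y => y - x := by
  have h1 : f =O[l] fun y => (y - x) ^ 2 :=
    Asymptotics.IsBigO.of_bound C (h.mono fun y hy => by simpa using hy)
  refine h1.trans_isLittleO ?_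
  have h2 : Tendsto (fun y => y - x) l (nhds 0) := by
    have : Tendsto (fun y => y - x) (nhds x) (nhds (x - x)) :=
      (continuous_sub_right x).tendsto x
    rw [sub_self] at this
    exact this.mono_left hl
  simpa [pow_two] using ((Asymptotics.isLittleO_one_iff ℝ).2 h2).mul_isBigO
    (Asymptotics.isBigO_refl (fun y => y - x) l)

section maximizer

variable {P0 : Measure ℝ} {lam q : ℝ}

lemma Maximizes.scalarFE_le (hlam : 0 < lam) (hq : Maximizes P0 lam q) {t : ℝ} (ht : 0 ≤ t) :
    scalarFE P0 t ≤ scalarFE P0 (lam * q) + q / 2 * (t - lam * q)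
      + (t - lam * q) ^ 2 / (4 * lam) := by
  have h := hq.2 (t / lam) (by positivity)
  simp only [RSpot, mul_div_cancel₀ t hlam.ne'] at h
  have e : q / 2 * (t - lam * q) + (t - lam * q) ^ 2 / (4 * lam)
      = lam / 4 * (t / lam) ^ 2 - lam / 4 * q ^ 2 := by
    field_simp
    ring
  linarith

variable [IsProbabilityMeasure P0]

lemma Maximizes.le_scalarFE (hmom : Integrable (fun x => x ^ 2) P0) (hlam : 0 < lam)
    (hq : Maximizes P0 lam q) {t : ℝ} (ht : |t - lam * q| < lam * q) :
    scalarFE P0 (lam * q) + q / 2 * (t - lam * q) - (t - lam * q) ^ 2 / (4 * lam)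
      ≤ scalarFE P0 t := by
  obtain ⟨h1, h2⟩ := abs_lt.1 ht
  have hup := hq.scalarFE_le hlam (t := 2 * (lam * q) - t) (by linarith)
  have hmid : 2 * scalarFE P0 (lam * q) ≤ scalarFE P0 t + scalarFE P0 (2 * (lam * q) - t) := by
    rcases lt_trichotomy t (lam * q) with hlt | rfl | hgt
    · have h := scalarFE_midpoint hmom (g := t) (d := lam * q - t) (by linarith) (by linarith)
      rwa [add_sub_cancel, show t + (lam * q - t + (lam * q - t)) = 2 * (lam * q) - t by ring] at h
    · rw [show 2 * (lam * q) - lam * q = lam * q by ring]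
      linarith
    · have h := scalarFE_midpoint hmom (g := 2 * (lam * q) - t) (d := t - lam * q)
        (by linarith) (by linarith)
      rw [show 2 * (lam * q) - t + (t - lam * q) = lam * q by ring,
        show 2 * (lam * q) - t + (t - lam * q + (t - lam * q)) = t by ring] at h
      linarith
  have e : (2 * (lam * q) - t - lam * q) ^ 2 = (t - lam * q) ^ 2 := by ring
  rw [e] at hup
  linarith

lemma Maximizes.hasDerivAt_scalarFE (hmom : Integrable (fun x => x ^ 2) P0) (hlam : 0 < lam)
    (hq : Maximizes P0 lam q) (hpos : 0 < q) :
    HasDerivAt (scalarFE P0) (q / 2) (lam * q) := by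
  have hg : 0 < lam * q := mul_pos hlam hpos
  rw [hasDerivAt_iff_isLittleO]
  refine isLittleO_sub_of_abs_le_sq (C := 1 / (4 * lam)) le_rfl ?_
  filter_upwards [Metric.ball_mem_nhds (lam * q) hg] with t ht
  rw [Metric.mem_ball, Real.dist_eq] at ht
  have hlow := hq.le_scalarFE hmom hlam ht
  have hup := hq.scalarFE_le hlam (t := t) (by linarith [(abs_lt.1 ht).1])
  rw [one_div_mul_eq_div, smul_eq_mul, abs_le]
  constructor <;> linarith

lemma Maximizes.le_secondMoment (hmom : Integrable (fun x => x ^ 2) P0) (hlam : 0 < lam)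
    (hq : Maximizes P0 lam q) (hpos : 0 < q) : q ≤ ∫ x, x ^ 2 ∂P0 := by
  have hg : 0 < lam * q := mul_pos hlam hpos
  by_contra! hcon
  set M := ∫ x, x ^ 2 ∂P0
  obtain ⟨d, hd0, hd⟩ := exists_between (lt_min hg (mul_pos hlam (sub_pos.2 hcon)))
  have hlow := hq.le_scalarFE hmom hlam (t := lam * q + d)
    (by rw [add_sub_cancel_left, abs_of_pos hd0]; exact (lt_min_iff.1 hd).1)
  have hup := scalarFE_add_le hmom hg hd0
  rw [add_sub_cancel_left] at hlow
  have h1 : d * (q - M) / 2 ≤ d * d / (4 * lam) := by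
    rw [← pow_two]
    linarith
  rw [div_le_div_iff₀ (by norm_num) (by positivity)] at h1
  have h2 : d * d < d * (lam * (q - M)) := mul_lt_mul_of_pos_left (lt_min_iff.1 hd).2 hd0
  nlinarith

lemma deriv_scalarFE_zero_of_maximizes (hmom : Integrable (fun x => x ^ 2) P0) (hlam : 0 < lam)
    (hq : Maximizes P0 lam 0) : deriv (scalarFE P0) 0 = 0 := by
  by_cases hdiff : DifferentiableAt ℝ (scalarFE P0) 0
  · refine UniqueDiffWithinAt.eq_deriv (Set.Ioi 0) (uniqueDiffWithinAt_Ioi 0)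
      hdiff.hasDerivAt.hasDerivWithinAt ?_
    rw [hasDerivWithinAt_iff_isLittleO]
    refine isLittleO_sub_of_abs_le_sq (C := 1 / (4 * lam)) inf_le_left ?_
    filter_upwards [self_mem_nhdsWithin] with t ht
    have hup := hq.scalarFE_le hlam (t := t) (le_of_lt ht)
    have hlow : 0 ≤ scalarFE P0 t := scalarFE_nonneg hmom (s := ⟨t, le_of_lt ht⟩) ht
    simp only [mul_zero, scalarFE_zero, sub_zero, zero_div, zero_mul, zero_add] at hup
    simpa [scalarFE_zero, abs_of_nonneg hlow, div_eq_inv_mul] using hup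
  · exact deriv_zero_of_not_differentiableAt hdiff

end maximizer


/-- **Any maximizer of the RS potential lies in `[0, E[X²]]` and satisfies the
fixed-point equation `q* = 2 ψ′_{P0}(λ q*)`.** -/
theorem maximizer_le_secondMoment_and_fixed_point (P0 : Measure ℝ)
    [IsProbabilityMeasure P0] (hmom : Integrable (fun x => x ^ 2) P0)
    (lam : ℝ) (hlam : 0 < lam) (q : ℝ) (hq : Maximizes P0 lam q) :
    q ≤ ∫ x, x ^ 2 ∂P0 ∧ q = 2 * deriv (scalarFE P0) (lam * q) := by
  rcases hq.1.eq_or_lt with rfl | hpos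
  · refine ⟨integral_nonneg fun x => sq_nonneg x, ?_⟩
    rw [mul_zero, deriv_scalarFE_zero_of_maximizes hmom hlam hq, mul_zero]
  · refine ⟨hq.le_secondMoment hmom hlam hpos, ?_⟩
    rw [(hq.hasDerivAt_scalarFE hmom hlam hpos).deriv]
    ring

end
end

section
/- State evolution converges: assume ∫x² dP0(x) = 1 and λ > 0, and define the sequence (q_t) by q_0 = max(0, 1 − λ^{-1}) and q_{t+1} = 2·ψ′_{P0}(λ·q_t). Then (q_t) converges to a limit q_∞ ≥ 0 satisfying q_∞ = 2·ψ′_{P0}(λ·q_∞). -/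
/-!
State evolution converges: assume `∫ x² dP0 = 1` and `λ > 0`, and define the sequence
`q_0 = max(0, 1 − λ⁻¹)`, `q_{t+1} = 2 ψ′_{P0}(λ q_t)`. Then `(q_t)` converges to a limit
`q_∞ ≥ 0` satisfying `q_∞ = 2 ψ′_{P0}(λ q_∞)`.
-/

open MeasureTheory ProbabilityTheory Filter Finset Real

noncomputable section

instance : IsProbabilityMeasure stdGauss := by
  unfold stdGauss; infer_instance

/-! ### Exponentially weighted moments -/

/-- The unnormalized posterior moment `∫ X^k exp(s z X − s²X²/2) dP`. -/
def tiltedMoment (P : Measure ℝ) (X : ℝ → ℝ) (k : ℕ) (s z : ℝ) : ℝ :=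
  ∫ x, X x ^ k * exp (s * z * X x - s ^ 2 / 2 * X x ^ 2) ∂P

/-- The second moment of the posterior mean, written under the Gaussian reference measure. -/
def overlap (P : Measure ℝ) (X : ℝ → ℝ) (s : ℝ) : ℝ :=
  ∫ z, tiltedMoment P X 1 s z ^ 2 / tiltedMoment P X 0 s z ∂stdGauss

lemma exp_tilt_le (s z x : ℝ) : exp (s * z * x - s ^ 2 / 2 * x ^ 2) ≤ exp (z ^ 2 / 2) := by
  apply exp_le_exp.2
  nlinarith [sq_nonneg (s * x - z)]

lemma le_exp_tilt (s z x : ℝ) :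
    exp (-z ^ 2 / 2 - s ^ 2 * x ^ 2) ≤ exp (s * z * x - s ^ 2 / 2 * x ^ 2) := by
  apply exp_le_exp.2
  nlinarith [sq_nonneg (s * x + z)]

lemma integrable_pow_of_le_two {P : Measure ℝ} [IsProbabilityMeasure P] {X : ℝ → ℝ}
    (hX : Measurable X) (hX2 : Integrable (fun x => X x ^ 2) P) {k : ℕ} (hk : k ≤ 2) :
    Integrable (fun x => |X x| ^ k) P := by
  refine ((integrable_const (1 : ℝ)).add hX2).mono' (by fun_prop) (ae_of_all _ fun x => ?_)
  rw [norm_of_nonneg (by positivity), Pi.add_apply, ← sq_abs (X x)]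
  interval_cases k <;> nlinarith [sq_nonneg (|X x| - 1)]

lemma tilt_norm_le (k : ℕ) (s z x : ℝ) :
    ‖x ^ k * exp (s * z * x - s ^ 2 / 2 * x ^ 2)‖ ≤ |x| ^ k * exp (z ^ 2 / 2) := by
  rw [norm_mul, norm_pow, norm_eq_abs, norm_eq_abs, abs_exp]
  exact mul_le_mul_of_nonneg_left (exp_tilt_le s z x) (by positivity)

lemma integrable_tilt {P : Measure ℝ} [IsProbabilityMeasure P] {X : ℝ → ℝ}
    (hX : Measurable X) (hX2 : Integrable (fun x => X x ^ 2) P) {k : ℕ} (hk : k ≤ 2) (s z : ℝ) :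
    Integrable (fun x => X x ^ k * exp (s * z * X x - s ^ 2 / 2 * X x ^ 2)) P :=
  ((integrable_pow_of_le_two hX hX2 hk).mul_const (exp (z ^ 2 / 2))).mono' (by fun_prop)
    (ae_of_all _ fun _ => tilt_norm_le ..)

lemma tendsto_tiltedMoment {P : Measure ℝ} [IsProbabilityMeasure P] {X : ℝ → ℝ}
    (hX : Measurable X) (hX2 : Integrable (fun x => X x ^ 2) P) {k : ℕ} (hk : k ≤ 2)
    {ι : Type*} {l : Filter ι} [l.IsCountablyGenerated] {Y : ι → ℝ → ℝ} {s z : ι → ℝ} {s₀ z₀ : ℝ}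
    (hY : ∀ i, Measurable (Y i)) (hYX : ∀ i x, |Y i x| ≤ |X x|)
    (hlim : ∀ x, Tendsto (fun i => Y i x) l (nhds (X x)))
    (hs : Tendsto s l (nhds s₀)) (hz : Tendsto z l (nhds z₀)) :
    Tendsto (fun i => tiltedMoment P (Y i) k (s i) (z i)) l
      (nhds (tiltedMoment P X k s₀ z₀)) := by
  unfold tiltedMoment
  refine tendsto_integral_filter_of_dominated_convergence
    (fun x => |X x| ^ k * exp ((|z₀| + 1) ^ 2 / 2)) ?_ ?_
    ((integrable_pow_of_le_two hX hX2 hk).mul_const _) (ae_of_all _ fun x => ?_)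
  · exact Eventually.of_forall fun i => by have := hY i; fun_prop
  · have h1 : ∀ᶠ i in l, |z i| < |z₀| + 1 :=
      hz.abs.eventually (gt_mem_nhds (by linarith))
    filter_upwards [h1] with i hi
    refine ae_of_all _ fun x => (tilt_norm_le ..).trans ?_
    have := hYX i x
    rw [← sq_abs (z i)]
    gcongr
  · have := hlim x
    refine (this.pow k).mul ((Real.continuous_exp.tendsto _).comp ?_)
    exact ((hs.mul hz).mul this).sub (((hs.pow 2).div_const 2).mul (this.pow 2))

lemma continuous_tiltedMoment {P : Measure ℝ} [IsProbabilityMeasure P] {X : ℝ → ℝ}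
    (hX : Measurable X) (hX2 : Integrable (fun x => X x ^ 2) P) {k : ℕ} (hk : k ≤ 2) :
    Continuous fun p : ℝ × ℝ => tiltedMoment P X k p.1 p.2 :=
  continuous_iff_continuousAt.2 fun p =>
    tendsto_tiltedMoment hX hX2 hk (Y := fun _ => X) (fun _ => hX) (fun _ _ => le_rfl)
      (fun _ => tendsto_const_nhds) (continuous_fst.tendsto p) (continuous_snd.tendsto p)

lemma continuous_tiltedMoment_right {P : Measure ℝ} [IsProbabilityMeasure P] {X : ℝ → ℝ}
    (hX : Measurable X) (hX2 : Integrable (fun x => X x ^ 2) P) {k : ℕ} (hk : k ≤ 2) (s : ℝ) :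
    Continuous (tiltedMoment P X k s) :=
  (continuous_tiltedMoment hX hX2 hk).comp (continuous_const.prodMk continuous_id)

lemma tiltedMoment_zero_pos {P : Measure ℝ} [IsProbabilityMeasure P] {X : ℝ → ℝ}
    (hX : Measurable X) (hX2 : Integrable (fun x => X x ^ 2) P) (s z : ℝ) :
    0 < tiltedMoment P X 0 s z := by
  have := integrable_tilt hX hX2 (k := 0) (by norm_num) s z
  simp only [pow_zero, one_mul] at this
  simpa [tiltedMoment] using integral_exp_pos this

lemma abs_log_tiltedMoment_le {P : Measure ℝ} [IsProbabilityMeasure P] {X : ℝ → ℝ}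
    (hX : Measurable X) (hX2 : Integrable (fun x => X x ^ 2) P) (s z : ℝ) :
    |Real.log (tiltedMoment P X 0 s z)| ≤ z ^ 2 / 2 + s ^ 2 * ∫ x, X x ^ 2 ∂P := by
  have hpos := tiltedMoment_zero_pos hX hX2 s z
  have hint := integrable_tilt hX hX2 (k := 0) (by norm_num) s z
  have hm : 0 ≤ ∫ x, X x ^ 2 ∂P := integral_nonneg fun x => sq_nonneg _
  have hint' : Integrable (fun x => -z ^ 2 / 2 - s ^ 2 * X x ^ 2) P :=
    (integrable_const _).sub (hX2.const_mul _)
  have hbd : ∀ x, exp (-z ^ 2 / 2 - s ^ 2 * X x ^ 2) ≤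
      X x ^ 0 * exp (s * z * X x - s ^ 2 / 2 * X x ^ 2) := fun x => by
    simpa using le_exp_tilt s z (X x)
  have hexp : Integrable (fun x => exp (-z ^ 2 / 2 - s ^ 2 * X x ^ 2)) P :=
    hint.mono' (by fun_prop) (ae_of_all _ fun x => by
      rw [norm_of_nonneg (exp_pos _).le]; exact hbd x)
  rw [abs_le]
  constructor
  · rw [le_log_iff_exp_le hpos]
    have h1 := convexOn_exp.map_integral_le (μ := P) continuous_exp.continuousOn isClosed_univ
      (ae_of_all _ fun _ => Set.mem_univ _) hint' hexp
    rw [integral_sub (integrable_const _) (hX2.const_mul _), integral_const_mul] at h1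
    simp only [integral_const, probReal_univ, one_smul] at h1
    refine le_trans (le_of_eq ?_) (h1.trans (integral_mono hexp hint hbd))
    congr 1; ring
  · rw [log_le_iff_le_exp hpos]
    have h1 : tiltedMoment P X 0 s z ≤ ∫ _, exp (z ^ 2 / 2) ∂P :=
      integral_mono hint (integrable_const _) fun x => by simpa using exp_tilt_le s z (X x)
    simp only [integral_const, probReal_univ, one_smul] at h1
    refine h1.trans (exp_le_exp.2 ?_)
    nlinarith [mul_nonneg (sq_nonneg s) hm]

lemma tiltedMoment_one_sq_div_le {P : Measure ℝ} [IsProbabilityMeasure P] {X : ℝ → ℝ}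
    (hX : Measurable X) (hX2 : Integrable (fun x => X x ^ 2) P) (s z : ℝ) :
    tiltedMoment P X 1 s z ^ 2 / tiltedMoment P X 0 s z ≤ tiltedMoment P X 2 s z := by
  have hpos := tiltedMoment_zero_pos hX hX2 s z
  set m := tiltedMoment P X 1 s z / tiltedMoment P X 0 s z with hm
  have i0 := integrable_tilt hX hX2 (k := 0) (by norm_num) s z
  have i1 := integrable_tilt hX hX2 (k := 1) (by norm_num) s z
  have i2 := integrable_tilt hX hX2 (k := 2) (by norm_num) s z
  have h : 0 ≤ ∫ x, (X x ^ 2 * exp (s * z * X x - s ^ 2 / 2 * X x ^ 2) -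
      (2 * m) * (X x ^ 1 * exp (s * z * X x - s ^ 2 / 2 * X x ^ 2))) +
      m ^ 2 * (X x ^ 0 * exp (s * z * X x - s ^ 2 / 2 * X x ^ 2)) ∂P := by
    refine integral_nonneg fun x => ?_
    have : 0 ≤ (X x - m) ^ 2 * exp (s * z * X x - s ^ 2 / 2 * X x ^ 2) := by positivity
    simp only [Pi.zero_apply]
    linarith
  rw [integral_add (by exact i2.sub (i1.const_mul _)) (i0.const_mul _),
    integral_sub i2 (i1.const_mul _), integral_const_mul, integral_const_mul] at h
  change 0 ≤ tiltedMoment P X 2 s z - 2 * m * tiltedMoment P X 1 s z +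
    m ^ 2 * tiltedMoment P X 0 s z at h
  have e : tiltedMoment P X 1 s z = m * tiltedMoment P X 0 s z := by
    rw [hm]; field_simp
  rw [e] at h ⊢
  rw [div_le_iff₀ hpos]
  nlinarith

/-! ### Gaussian averages -/

lemma integrable_exp_mul_stdGauss (a : ℝ) : Integrable (fun z => exp (a * z)) stdGauss :=
  integrable_exp_mul_gaussianReal a

lemma integral_exp_mul_stdGauss (a : ℝ) : ∫ z, exp (a * z) ∂stdGauss = exp (a ^ 2 / 2) := by
  have := congrFun (mgf_fun_id_gaussianReal (μ := 0) (v := 1)) a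
  simpa [mgf, stdGauss] using this

lemma map_rotate_stdGauss {a b : ℝ} (hab : a ^ 2 + b ^ 2 = 1) :
    (stdGauss.prod stdGauss).map (fun p : ℝ × ℝ => a * p.1 + b * p.2) = stdGauss := by
  have h1 : (fun p : ℝ × ℝ => a * p.1 + b * p.2) =
      (fun p : ℝ × ℝ => p.1 + p.2) ∘ Prod.map (a * ·) (b * ·) := rfl
  rw [h1, ← Measure.map_map (by fun_prop) (by fun_prop),
    ← Measure.map_prod_map _ _ (by fun_prop) (by fun_prop)]
  unfold stdGauss
  rw [gaussianReal_map_const_mul, gaussianReal_map_const_mul]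
  change Measure.conv _ _ = _
  rw [gaussianReal_conv_gaussianReal]
  congr 1
  · simp
  · ext; simpa using hab

lemma integral_tilt_rotate {a b : ℝ} (hab : a ^ 2 + b ^ 2 = 1) (s z x : ℝ) :
    Integrable (fun w => exp (s * (a * z + b * w) * x - s ^ 2 / 2 * x ^ 2)) stdGauss ∧
    ∫ w, exp (s * (a * z + b * w) * x - s ^ 2 / 2 * x ^ 2) ∂stdGauss =
      exp ((a * s) * z * x - (a * s) ^ 2 / 2 * x ^ 2) := by
  have h : (fun w => exp (s * (a * z + b * w) * x - s ^ 2 / 2 * x ^ 2)) =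
      fun w => exp (s * a * z * x - s ^ 2 / 2 * x ^ 2) * exp ((s * b * x) * w) := by
    funext w; rw [← exp_add]; congr 1; ring
  rw [h]
  refine ⟨(integrable_exp_mul_stdGauss _).const_mul _, ?_⟩
  rw [integral_const_mul, integral_exp_mul_stdGauss, ← exp_add]
  congr 1
  have : b ^ 2 = 1 - a ^ 2 := by linarith
  linear_combination s ^ 2 * x ^ 2 / 2 * this

lemma tiltedMoment_rotate {P : Measure ℝ} [IsProbabilityMeasure P] {X : ℝ → ℝ}
    (hX : Measurable X) (hX2 : Integrable (fun x => X x ^ 2) P) {k : ℕ} (hk : k ≤ 2)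
    {a b : ℝ} (hab : a ^ 2 + b ^ 2 = 1) (s z : ℝ) :
    Integrable (fun w => tiltedMoment P X k s (a * z + b * w)) stdGauss ∧
    ∫ w, tiltedMoment P X k s (a * z + b * w) ∂stdGauss = tiltedMoment P X k (a * s) z := by
  have hint : Integrable (Function.uncurry fun w x =>
      X x ^ k * exp (s * (a * z + b * w) * X x - s ^ 2 / 2 * X x ^ 2)) (stdGauss.prod P) := by
    rw [integrable_prod_iff' (by unfold Function.uncurry; fun_prop)]
    refine ⟨ae_of_all _ fun x => by
      exact (integral_tilt_rotate hab s z (X x)).1.const_mul (X x ^ k), ?_⟩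
    have : ∀ x, ∫ w, ‖X x ^ k * exp (s * (a * z + b * w) * X x - s ^ 2 / 2 * X x ^ 2)‖ ∂stdGauss
        = ‖X x ^ k * exp ((a * s) * z * X x - (a * s) ^ 2 / 2 * X x ^ 2)‖ := fun x => by
      simp only [norm_mul, norm_eq_abs, abs_exp]
      rw [integral_const_mul, (integral_tilt_rotate hab s z (X x)).2]
    simp only [Function.uncurry, this]
    exact (integrable_tilt hX hX2 hk _ _).norm
  refine ⟨hint.integral_prod_left, ?_⟩
  unfold tiltedMoment
  rw [integral_integral_swap hint]
  refine integral_congr_ae (ae_of_all _ fun x => ?_)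
  simp only
  rw [integral_const_mul, (integral_tilt_rotate hab s z (X x)).2]

lemma integral_tiltedMoment {P : Measure ℝ} [IsProbabilityMeasure P] {X : ℝ → ℝ}
    (hX : Measurable X) (hX2 : Integrable (fun x => X x ^ 2) P) {k : ℕ} (hk : k ≤ 2) (s : ℝ) :
    Integrable (tiltedMoment P X k s) stdGauss ∧
    ∫ w, tiltedMoment P X k s w ∂stdGauss = ∫ x, X x ^ k ∂P := by
  have := tiltedMoment_rotate hX hX2 hk (a := 0) (b := 1) (by norm_num) s 0
  simp only [zero_mul, one_mul, zero_add] at this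
  refine ⟨this.1, this.2.trans ?_⟩
  simp [tiltedMoment]

/-- Dominated convergence with a varying dominating family whose integrals converge. -/
lemma tendsto_integral_of_le_of_tendsto {α ι : Type*} [MeasurableSpace α] {μ : Measure α}
    {l : Filter ι} [l.IsCountablyGenerated] {f g : ι → α → ℝ} {f₀ g₀ : α → ℝ}
    (hf : ∀ i, AEStronglyMeasurable (f i) μ) (hg : ∀ i, Integrable (g i) μ)
    (hg₀ : Integrable g₀ μ) (hf_nonneg : ∀ i a, 0 ≤ f i a) (hfg : ∀ i a, f i a ≤ g i a)
    (hfg₀ : ∀ a, f₀ a ≤ g₀ a)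
    (hg₀_nonneg : ∀ a, 0 ≤ g₀ a) (hf_lim : ∀ a, Tendsto (fun i => f i a) l (nhds (f₀ a)))
    (hg_lim : ∀ a, Tendsto (fun i => g i a) l (nhds (g₀ a)))
    (hg_int : Tendsto (fun i => ∫ a, g i a ∂μ) l (nhds (∫ a, g₀ a ∂μ))) :
    Tendsto (fun i => ∫ a, f i a ∂μ) l (nhds (∫ a, f₀ a ∂μ)) := by
  have hfi : ∀ i, Integrable (f i) μ := fun i =>
    (hg i).mono' (hf i) (ae_of_all _ fun a => by
      rw [norm_of_nonneg (hf_nonneg i a)]; exact hfg i a)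
  have key : ∀ (h : ι → α → ℝ) (h₀ : α → ℝ), (∀ i, Integrable (h i) μ) → (∀ i a, 0 ≤ h i a) →
      (∀ a, h₀ a ≤ g₀ a) → (∀ a, Tendsto (fun i => h i a) l (nhds (h₀ a))) →
      Tendsto (fun i => ∫ a, min (h i a) (g₀ a) ∂μ) l (nhds (∫ a, h₀ a ∂μ)) := by
    intro h h₀ hh hn hle hl
    refine tendsto_integral_filter_of_dominated_convergence g₀
      (Eventually.of_forall fun i => ((hh i).inf hg₀).aestronglyMeasurable)
      (Eventually.of_forall fun i => ae_of_all _ fun a => ?_) hg₀ (ae_of_all _ fun a => ?_)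
    · rw [norm_of_nonneg (le_min (hn i a) (hg₀_nonneg a))]
      exact min_le_right _ _
    · have := (hl a).min (tendsto_const_nhds (x := g₀ a))
      rwa [min_eq_left (hle a)] at this
  have k1 := key f f₀ hfi hf_nonneg hfg₀ hf_lim
  have k2 := key g g₀ hg (fun i a => (hf_nonneg i a).trans (hfg i a)) (fun _ => le_rfl) hg_lim
  have k3 : Tendsto (fun i => ∫ a, f i a ∂μ - ∫ a, min (f i a) (g₀ a) ∂μ) l (nhds 0) := by
    refine tendsto_of_tendsto_of_tendsto_of_le_of_le tendsto_const_nhds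
      (h := fun i => ∫ a, g i a ∂μ - ∫ a, min (g i a) (g₀ a) ∂μ)
      (by simpa using hg_int.sub k2) (fun i => ?_) (fun i => ?_)
    · exact sub_nonneg.2 (integral_mono ((hfi i).inf hg₀) (hfi i) fun a => min_le_left _ _)
    · simp only
      rw [← integral_sub (hfi i) (by exact (hfi i).inf hg₀),
        ← integral_sub (hg i) (by exact (hg i).inf hg₀)]
      refine integral_mono ((hfi i).sub ((hfi i).inf hg₀)) ((hg i).sub ((hg i).inf hg₀))
        fun a => ?_
      have := hfg i a
      simp only
      rcases le_total (f i a) (g₀ a) with h1 | h1 <;> rcases le_total (g i a) (g₀ a) with h2 | h2 <;>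
        simp only [h1, h2, min_eq_left, min_eq_right] <;> linarith
  simpa using k3.add k1

lemma integrable_sq_of_abs_le {P : Measure ℝ} {X : ℝ → ℝ}
    (hX2 : Integrable (fun x => X x ^ 2) P) {Y : ℝ → ℝ}
    (hY : Measurable Y) (hYX : ∀ x, |Y x| ≤ |X x|) : Integrable (fun x => Y x ^ 2) P :=
  hX2.mono' (by fun_prop) (ae_of_all _ fun x => by
    rw [norm_of_nonneg (sq_nonneg _)]; exact sq_le_sq.2 (hYX x))

section Overlap

variable {P : Measure ℝ} [IsProbabilityMeasure P] {X : ℝ → ℝ}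

lemma overlap_integrand_nonneg (hX : Measurable X) (hX2 : Integrable (fun x => X x ^ 2) P)
    (s z : ℝ) : 0 ≤ tiltedMoment P X 1 s z ^ 2 / tiltedMoment P X 0 s z :=
  div_nonneg (sq_nonneg _) (tiltedMoment_zero_pos hX hX2 s z).le

lemma continuous_overlap_integrand (hX : Measurable X) (hX2 : Integrable (fun x => X x ^ 2) P)
    (s : ℝ) : Continuous fun z => tiltedMoment P X 1 s z ^ 2 / tiltedMoment P X 0 s z :=
  ((continuous_tiltedMoment_right hX hX2 (by norm_num) s).pow 2).div
    (continuous_tiltedMoment_right hX hX2 (by norm_num) s)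
    fun z => (tiltedMoment_zero_pos hX hX2 s z).ne'

lemma integrable_overlap_integrand (hX : Measurable X) (hX2 : Integrable (fun x => X x ^ 2) P)
    (s : ℝ) :
    Integrable (fun z => tiltedMoment P X 1 s z ^ 2 / tiltedMoment P X 0 s z) stdGauss :=
  (integral_tiltedMoment hX hX2 le_rfl s).1.mono'
    (continuous_overlap_integrand hX hX2 s).aestronglyMeasurable (ae_of_all _ fun z => by
      rw [norm_of_nonneg (overlap_integrand_nonneg hX hX2 s z)]
      exact tiltedMoment_one_sq_div_le hX hX2 s z)

lemma overlap_nonneg (hX : Measurable X) (hX2 : Integrable (fun x => X x ^ 2) P) (s : ℝ) :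
    0 ≤ overlap P X s :=
  integral_nonneg fun z => overlap_integrand_nonneg hX hX2 s z

lemma overlap_le (hX : Measurable X) (hX2 : Integrable (fun x => X x ^ 2) P) (s : ℝ) :
    overlap P X s ≤ ∫ x, X x ^ 2 ∂P := by
  rw [← (integral_tiltedMoment hX hX2 le_rfl s).2]
  exact integral_mono (integrable_overlap_integrand hX hX2 s)
    (integral_tiltedMoment hX hX2 le_rfl s).1 fun z => tiltedMoment_one_sq_div_le hX hX2 s z

lemma tendsto_overlap (hX : Measurable X) (hX2 : Integrable (fun x => X x ^ 2) P)
    {ι : Type*} {l : Filter ι} [l.IsCountablyGenerated] {Y : ι → ℝ → ℝ} {s : ι → ℝ} {s₀ : ℝ}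
    (hY : ∀ i, Measurable (Y i)) (hYX : ∀ i x, |Y i x| ≤ |X x|)
    (hlim : ∀ x, Tendsto (fun i => Y i x) l (nhds (X x))) (hs : Tendsto s l (nhds s₀)) :
    Tendsto (fun i => overlap P (Y i) (s i)) l (nhds (overlap P X s₀)) := by
  have hY2 : ∀ i, Integrable (fun x => Y i x ^ 2) P := fun i =>
    integrable_sq_of_abs_le hX2 (hY i) (hYX i)
  refine tendsto_integral_of_le_of_tendsto
    (g := fun i => tiltedMoment P (Y i) 2 (s i)) (g₀ := tiltedMoment P X 2 s₀)
    (fun i => (continuous_overlap_integrand (hY i) (hY2 i) (s i)).aestronglyMeasurable)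
    (fun i => (integral_tiltedMoment (hY i) (hY2 i) le_rfl (s i)).1)
    (integral_tiltedMoment hX hX2 le_rfl s₀).1
    (fun i z => overlap_integrand_nonneg (hY i) (hY2 i) (s i) z)
    (fun i z => tiltedMoment_one_sq_div_le (hY i) (hY2 i) (s i) z)
    (fun z => tiltedMoment_one_sq_div_le hX hX2 s₀ z)
    (fun z => (overlap_integrand_nonneg hX hX2 s₀ z).trans
      (tiltedMoment_one_sq_div_le hX hX2 s₀ z))
    (fun z => ?_)
    (fun z => tendsto_tiltedMoment hX hX2 le_rfl hY hYX hlim hs tendsto_const_nhds) ?_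
  · exact ((tendsto_tiltedMoment hX hX2 (by norm_num) hY hYX hlim hs tendsto_const_nhds).pow 2).div
      (tendsto_tiltedMoment hX hX2 (by norm_num) hY hYX hlim hs tendsto_const_nhds)
      (tiltedMoment_zero_pos hX hX2 s₀ z).ne'
  · simp only [(integral_tiltedMoment hX hX2 le_rfl s₀).2,
      fun i => (integral_tiltedMoment (hY i) (hY2 i) le_rfl (s i)).2]
    exact tendsto_integral_filter_of_dominated_convergence (fun x => X x ^ 2)
      (Eventually.of_forall fun i => (hY2 i).aestronglyMeasurable)
      (Eventually.of_forall fun i => ae_of_all _ fun x => by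
        rw [norm_of_nonneg (sq_nonneg _)]; exact sq_le_sq.2 (hYX i x)) hX2
      (ae_of_all _ fun x => (hlim x).pow 2)

lemma continuous_overlap (hX : Measurable X) (hX2 : Integrable (fun x => X x ^ 2) P) :
    Continuous (overlap P X) :=
  continuous_iff_continuousAt.2 fun s =>
    tendsto_overlap hX hX2 (Y := fun _ => X) (fun _ => hX) (fun _ _ => le_rfl)
      (fun _ => tendsto_const_nhds) (continuous_id.tendsto s)

lemma overlap_mul_le (hX : Measurable X) (hX2 : Integrable (fun x => X x ^ 2) P)
    {a : ℝ} (ha : a ^ 2 ≤ 1) (s : ℝ) : overlap P X (a * s) ≤ overlap P X s := by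
  obtain ⟨b, hab⟩ : ∃ b, a ^ 2 + b ^ 2 = 1 :=
    ⟨√(1 - a ^ 2), by rw [sq_sqrt (by linarith)]; ring⟩
  set H : ℝ → ℝ := fun z => tiltedMoment P X 1 s z ^ 2 / tiltedMoment P X 0 s z with hH
  have hHint : Integrable H stdGauss := integrable_overlap_integrand hX hX2 s
  have hrot : Integrable (fun p : ℝ × ℝ => H (a * p.1 + b * p.2)) (stdGauss.prod stdGauss) := by
    rw [← map_rotate_stdGauss hab] at hHint
    exact hHint.comp_measurable (by fun_prop)
  have hs : overlap P X s = ∫ z, ∫ w, H (a * z + b * w) ∂stdGauss ∂stdGauss := by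
    rw [integral_integral hrot]
    conv_lhs => rw [overlap, ← map_rotate_stdGauss hab]
    exact integral_map (by fun_prop)
      (continuous_overlap_integrand hX hX2 s).aestronglyMeasurable
  rw [hs]
  refine integral_mono_ae (integrable_overlap_integrand hX hX2 _) hrot.integral_prod_left ?_
  filter_upwards [hrot.prod_right_ae] with z hz
  obtain ⟨i0, e0⟩ := tiltedMoment_rotate hX hX2 (k := 0) (by norm_num) hab s z
  obtain ⟨i1, e1⟩ := tiltedMoment_rotate hX hX2 (k := 1) (by norm_num) hab s z
  have hpos := tiltedMoment_zero_pos hX hX2 (a * s) z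
  set m := tiltedMoment P X 1 (a * s) z / tiltedMoment P X 0 (a * s) z with hm
  have h : ∫ w, (2 * m * tiltedMoment P X 1 s (a * z + b * w) -
      m ^ 2 * tiltedMoment P X 0 s (a * z + b * w)) ∂stdGauss ≤
      ∫ w, H (a * z + b * w) ∂stdGauss := by
    refine integral_mono ((i1.const_mul _).sub (i0.const_mul _)) hz fun w => ?_
    have hp := tiltedMoment_zero_pos hX hX2 s (a * z + b * w)
    simp only [hH]
    rw [le_div_iff₀ hp]
    nlinarith [sq_nonneg (tiltedMoment P X 1 s (a * z + b * w) -
      m * tiltedMoment P X 0 s (a * z + b * w))]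
  rw [integral_sub (i1.const_mul _) (i0.const_mul _), integral_const_mul, integral_const_mul,
    e0, e1] at h
  refine le_trans (le_of_eq ?_) h
  rw [hm]
  field_simp
  ring

lemma overlap_mono (hX : Measurable X) (hX2 : Integrable (fun x => X x ^ 2) P) {s t : ℝ}
    (hs : 0 ≤ s) (hst : s ≤ t) : overlap P X s ≤ overlap P X t := by
  rcases hs.eq_or_lt with rfl | hs
  · simpa using overlap_mul_le hX hX2 (a := 0) (by norm_num) t
  · have ht : 0 < t := hs.trans_le hst
    have h := overlap_mul_le hX hX2 (a := s / t)
      (pow_le_one₀ (by positivity) ((div_le_one ht).2 hst)) t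
    rwa [div_mul_cancel₀ _ ht.ne'] at h

end Overlap

/-! ### Gaussian integration by parts and the derivative of the free energy -/

lemma integrable_exp_mul_abs_stdGauss (a : ℝ) : Integrable (fun z => exp (a * |z|)) stdGauss :=
  integrable_exp_mul_abs (integrable_exp_mul_stdGauss a) (integrable_exp_mul_stdGauss (-a))

lemma integrable_of_le_exp {h : ℝ → ℝ} (hc : Continuous h) {K a : ℝ}
    (hb : ∀ z, |h z| ≤ K * exp (a * |z|)) : Integrable h stdGauss :=
  ((integrable_exp_mul_abs_stdGauss a).const_mul K).mono' hc.aestronglyMeasurable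
    (ae_of_all _ hb)

lemma integrable_stdGauss_iff {h : ℝ → ℝ} :
    Integrable h stdGauss ↔ Integrable (fun z => gaussianPDFReal 0 1 z * h z) := by
  rw [stdGauss, gaussianReal_of_var_ne_zero 0 one_ne_zero,
    integrable_withDensity_iff_integrable_smul' (measurable_gaussianPDF 0 1)
      (ae_of_all _ fun _ => gaussianPDF_lt_top)]
  simp [toReal_gaussianPDF]

lemma integral_stdGauss (h : ℝ → ℝ) :
    ∫ z, h z ∂stdGauss = ∫ z, gaussianPDFReal 0 1 z * h z := by
  simp [stdGauss, integral_gaussianReal_eq_integral_smul]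

lemma hasDerivAt_gaussianPDFReal (z : ℝ) :
    HasDerivAt (gaussianPDFReal 0 1) (-z * gaussianPDFReal 0 1 z) z := by
  have h : HasDerivAt (fun z : ℝ => -(z - 0) ^ 2 / (2 * ((1 : NNReal) : ℝ))) (-z) z := by
    have := ((((hasDerivAt_id z).sub_const 0).pow 2).neg).div_const (2 * ((1 : NNReal) : ℝ))
    refine this.congr_deriv ?_
    simp
    ring
  refine (h.exp.const_mul (√(2 * π * (1 : NNReal)))⁻¹).congr_deriv ?_
  rw [gaussianPDFReal]
  ring

/-- Stein's identity. -/
lemma integral_id_mul_stdGauss {h h' : ℝ → ℝ} (hd : ∀ z, HasDerivAt h (h' z) z)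
    (hi : Integrable h stdGauss) (hzi : Integrable (fun z => z * h z) stdGauss)
    (hi' : Integrable h' stdGauss) : ∫ z, z * h z ∂stdGauss = ∫ z, h' z ∂stdGauss := by
  rw [integrable_stdGauss_iff] at hi hzi hi'
  have := integral_mul_deriv_eq_deriv_mul_of_integrable (u := h) (v := gaussianPDFReal 0 1)
    (u' := h') (v' := fun z => -z * gaussianPDFReal 0 1 z) (fun z _ => hd z)
    (fun z _ => hasDerivAt_gaussianPDFReal z)
    (hzi.neg.congr (ae_of_all _ fun z => by simp; ring))
    (hi'.congr (ae_of_all _ fun z => by simp; ring))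
    (hi.congr (ae_of_all _ fun z => by simp; ring))
  rw [integral_stdGauss, integral_stdGauss]
  rw [← neg_inj, ← integral_neg]
  convert this using 1
  · congr 1; funext z; ring
  · congr 1; congr 1; funext z; ring

lemma sq_div_two_le_exp_abs (z : ℝ) : z ^ 2 / 2 ≤ exp |z| := by
  have := quadratic_le_exp_of_nonneg (abs_nonneg z)
  rw [sq_abs] at this
  linarith [abs_nonneg z]

section Bounded

variable {P : Measure ℝ} [IsProbabilityMeasure P] {X : ℝ → ℝ} {C : ℝ}

lemma abs_pow_mul_tilt_le {x : ℝ} (hx : |x| ≤ C) (k : ℕ) (s z : ℝ) :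
    |x ^ k * exp (s * z * x - s ^ 2 / 2 * x ^ 2)| ≤ C ^ k * exp (|s| * C * |z|) := by
  have hC0 : 0 ≤ C := (abs_nonneg _).trans hx
  rw [abs_mul, abs_pow, abs_exp]
  have h : s * z * x - s ^ 2 / 2 * x ^ 2 ≤ |s| * C * |z| := by
    have h1 : s * z * x ≤ |s| * |z| * |x| := by
      rw [← abs_mul, ← abs_mul]; exact le_abs_self _
    have h2 : |s| * |z| * |x| ≤ |s| * |z| * C := by gcongr
    nlinarith [sq_nonneg (s * x)]
  gcongr

lemma integrable_tilt_of_bounded (hX : Measurable X) (hC : ∀ x, |X x| ≤ C) (k : ℕ) (s z : ℝ) :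
    Integrable (fun x => X x ^ k * exp (s * z * X x - s ^ 2 / 2 * X x ^ 2)) P :=
  (integrable_const (C ^ k * exp (|s| * C * |z|))).mono' (by fun_prop)
    (ae_of_all _ fun x => abs_pow_mul_tilt_le (hC x) k s z)

lemma integrable_sq_of_bounded (hX : Measurable X) (hC : ∀ x, |X x| ≤ C) :
    Integrable (fun x => X x ^ 2) P :=
  (integrable_const (C ^ 2)).mono' (by fun_prop) (ae_of_all _ fun x => by
    rw [norm_pow, norm_eq_abs]; exact pow_le_pow_left₀ (abs_nonneg _) (hC x) 2)

lemma abs_tiltedMoment_le (hC : ∀ x, |X x| ≤ C) (k : ℕ) (s z : ℝ) :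
    |tiltedMoment P X k s z| ≤ C ^ k * exp (|s| * C * |z|) := by
  have := norm_integral_le_of_norm_le_const (μ := P)
    (f := fun x => X x ^ k * exp (s * z * X x - s ^ 2 / 2 * X x ^ 2))
    (ae_of_all _ fun x => abs_pow_mul_tilt_le (hC x) k s z)
  simpa [tiltedMoment] using this

lemma hasDerivAt_tiltedMoment_left (hX : Measurable X) (hC : ∀ x, |X x| ≤ C) (k : ℕ) (s z : ℝ) :
    HasDerivAt (fun s => tiltedMoment P X k s z)
      (z * tiltedMoment P X (k + 1) s z - s * tiltedMoment P X (k + 2) s z) s := by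
  have h := hasDerivAt_integral_of_dominated_loc_of_deriv_le (μ := P)
    (F := fun s x => X x ^ k * exp (s * z * X x - s ^ 2 / 2 * X x ^ 2))
    (F' := fun s x => z * (X x ^ (k + 1) * exp (s * z * X x - s ^ 2 / 2 * X x ^ 2)) -
      s * (X x ^ (k + 2) * exp (s * z * X x - s ^ 2 / 2 * X x ^ 2)))
    (bound := fun _ => |z| * (C ^ (k + 1) * exp ((|s| + 1) * C * |z|)) +
      (|s| + 1) * (C ^ (k + 2) * exp ((|s| + 1) * C * |z|)))
    (Metric.ball_mem_nhds s one_pos) (Eventually.of_forall fun t => by fun_prop)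
    (integrable_tilt_of_bounded hX hC k s z) (by fun_prop) (ae_of_all _ fun x t ht => ?_)
    (integrable_const _) (ae_of_all _ fun x t _ => ?_)
  · have h2 := h.2
    rwa [integral_sub ((integrable_tilt_of_bounded hX hC _ s z).const_mul _)
      ((integrable_tilt_of_bounded hX hC _ s z).const_mul _), integral_const_mul,
      integral_const_mul] at h2
  · have hC0 : 0 ≤ C := (abs_nonneg _).trans (hC x)
    have ht' : |t| ≤ |s| + 1 := by
      rw [Metric.mem_ball, dist_eq] at ht
      have := abs_add_le s (t - s)
      rw [add_sub_cancel] at this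
      linarith
    have e : exp (|t| * C * |z|) ≤ exp ((|s| + 1) * C * |z|) := by gcongr
    refine (norm_sub_le _ _).trans ?_
    rw [norm_mul z, norm_mul t, norm_eq_abs, norm_eq_abs, norm_eq_abs, norm_eq_abs]
    have b1 := (abs_pow_mul_tilt_le (hC x) (k + 1) t z).trans
      (mul_le_mul_of_nonneg_left e (by positivity))
    have b2 := (abs_pow_mul_tilt_le (hC x) (k + 2) t z).trans
      (mul_le_mul_of_nonneg_left e (by positivity))
    exact add_le_add (mul_le_mul_of_nonneg_left b1 (abs_nonneg z))
      (mul_le_mul ht' b2 (abs_nonneg _) (by positivity))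
  · have h1 : HasDerivAt (fun t => t * z * X x - t ^ 2 / 2 * X x ^ 2)
        (z * X x - t * X x ^ 2) t := by
      have := (((hasDerivAt_id t).mul_const z).mul_const (X x)).sub
        ((((hasDerivAt_id t).pow 2).div_const 2).mul_const (X x ^ 2))
      refine this.congr_deriv ?_
      simp
    refine (h1.exp.const_mul (X x ^ k)).congr_deriv ?_
    ring

lemma hasDerivAt_tiltedMoment_right (hX : Measurable X) (hC : ∀ x, |X x| ≤ C) (k : ℕ) (s z : ℝ) :
    HasDerivAt (tiltedMoment P X k s) (s * tiltedMoment P X (k + 1) s z) z := by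
  have h := hasDerivAt_integral_of_dominated_loc_of_deriv_le (μ := P)
    (F := fun z x => X x ^ k * exp (s * z * X x - s ^ 2 / 2 * X x ^ 2))
    (F' := fun z x => s * (X x ^ (k + 1) * exp (s * z * X x - s ^ 2 / 2 * X x ^ 2)))
    (bound := fun _ => |s| * (C ^ (k + 1) * exp (|s| * C * (|z| + 1))))
    (Metric.ball_mem_nhds z one_pos) (Eventually.of_forall fun t => by fun_prop)
    (integrable_tilt_of_bounded hX hC k s z) (by fun_prop) (ae_of_all _ fun x t ht => ?_)
    (integrable_const _) (ae_of_all _ fun x t _ => ?_)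
  · have h2 := h.2
    rwa [integral_const_mul] at h2
  · have hC0 : 0 ≤ C := (abs_nonneg _).trans (hC x)
    have ht' : |t| ≤ |z| + 1 := by
      rw [Metric.mem_ball, dist_eq] at ht
      have := abs_add_le z (t - z)
      rw [add_sub_cancel] at this
      linarith
    have e : exp (|s| * C * |t|) ≤ exp (|s| * C * (|z| + 1)) := by gcongr
    rw [norm_mul s, norm_eq_abs, norm_eq_abs]
    have b1 := (abs_pow_mul_tilt_le (hC x) (k + 1) s t).trans
      (mul_le_mul_of_nonneg_left e (by positivity))
    exact mul_le_mul_of_nonneg_left b1 (abs_nonneg s)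
  · have h1 : HasDerivAt (fun t => s * t * X x - s ^ 2 / 2 * X x ^ 2) (s * X x) t := by
      have := (((hasDerivAt_id t).const_mul s).mul_const (X x)).sub_const (s ^ 2 / 2 * X x ^ 2)
      refine this.congr_deriv ?_
      simp
    refine (h1.exp.const_mul (X x ^ k)).congr_deriv ?_
    ring

lemma abs_log_tiltedMoment_add_one_le (hX : Measurable X) (hC : ∀ x, |X x| ≤ C) {s S : ℝ}
    (hs : |s| ≤ S) (z : ℝ) :
    |Real.log (tiltedMoment P X 0 s z) + 1| ≤ (S ^ 2 * C ^ 2 + 2) * exp |z| := by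
  have h1 := abs_log_tiltedMoment_le hX (integrable_sq_of_bounded (P := P) hX hC) s z
  have h2 : ∫ x, X x ^ 2 ∂P ≤ C ^ 2 := by
    have := integral_mono (integrable_sq_of_bounded (P := P) hX hC) (integrable_const (C ^ 2))
      fun x => sq_le_sq' (by linarith [neg_abs_le (X x), hC x]) ((le_abs_self _).trans (hC x))
    simpa using this
  have h3 := sq_div_two_le_exp_abs z
  have h4 : 1 ≤ exp |z| := one_le_exp (abs_nonneg z)
  have h5 : s ^ 2 ≤ S ^ 2 := by rw [← sq_abs s]; gcongr
  have h6 : s ^ 2 * ∫ x, X x ^ 2 ∂P ≤ S ^ 2 * C ^ 2 := by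
    have : 0 ≤ ∫ x, X x ^ 2 ∂P := integral_nonneg fun x => sq_nonneg _
    gcongr
  have h7 : S ^ 2 * C ^ 2 ≤ S ^ 2 * C ^ 2 * exp |z| := le_mul_of_one_le_right (by positivity) h4
  have h8 := abs_add_le (Real.log (tiltedMoment P X 0 s z)) 1
  rw [abs_one] at h8
  linarith

lemma continuous_log_tiltedMoment (hX : Measurable X) (hX2 : Integrable (fun x => X x ^ 2) P)
    (s : ℝ) : Continuous fun z => Real.log (tiltedMoment P X 0 s z) :=
  (continuous_tiltedMoment_right hX hX2 (by norm_num) s).log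
    fun z => (tiltedMoment_zero_pos hX hX2 s z).ne'

lemma integrable_log_mul_tiltedMoment (hX : Measurable X) (hC : ∀ x, |X x| ≤ C) {k : ℕ}
    (hk : k ≤ 2) (s : ℝ) :
    Integrable (fun z => (Real.log (tiltedMoment P X 0 s z) + 1) * tiltedMoment P X k s z)
      stdGauss ∧
    Integrable (fun z => z * ((Real.log (tiltedMoment P X 0 s z) + 1) * tiltedMoment P X k s z))
      stdGauss := by
  have hX2 := integrable_sq_of_bounded (P := P) hX hC
  have c : Continuous fun z =>
      (Real.log (tiltedMoment P X 0 s z) + 1) * tiltedMoment P X k s z :=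
    ((continuous_log_tiltedMoment hX hX2 s).add continuous_const).mul
      (continuous_tiltedMoment_right hX hX2 hk s)
  have hC0 : 0 ≤ C := (abs_nonneg _).trans (hC 0)
  have b : ∀ z, |(Real.log (tiltedMoment P X 0 s z) + 1) * tiltedMoment P X k s z| ≤
      ((|s| ^ 2 * C ^ 2 + 2) * C ^ k) * exp ((|s| * C + 1) * |z|) := fun z => by
    rw [abs_mul]
    refine (mul_le_mul (abs_log_tiltedMoment_add_one_le hX hC le_rfl z)
      (abs_tiltedMoment_le hC k s z) (abs_nonneg _) (by positivity)).trans (le_of_eq ?_)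
    rw [show (|s| * C + 1) * |z| = |z| + |s| * C * |z| by ring, exp_add]
    ring
  refine ⟨integrable_of_le_exp c b, integrable_of_le_exp (continuous_id.mul c)
    (K := (|s| ^ 2 * C ^ 2 + 2) * C ^ k) (a := |s| * C + 2) fun z => ?_⟩
  rw [abs_mul]
  refine (mul_le_mul ((le_add_of_nonneg_right zero_le_one).trans (add_one_le_exp |z|)) (b z)
    (abs_nonneg _) (exp_pos _).le).trans (le_of_eq ?_)
  rw [show (|s| * C + 2) * |z| = |z| + (|s| * C + 1) * |z| by ring, exp_add]
  ring

lemma integral_mul_log_tiltedMoment (hX : Measurable X) (hC : ∀ x, |X x| ≤ C) (s : ℝ) :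
    ∫ z, z * ((Real.log (tiltedMoment P X 0 s z) + 1) * tiltedMoment P X 1 s z) ∂stdGauss =
      s * overlap P X s +
        s * ∫ z, (Real.log (tiltedMoment P X 0 s z) + 1) * tiltedMoment P X 2 s z ∂stdGauss := by
  have hX2 := integrable_sq_of_bounded (P := P) hX hC
  have i2 := (integrable_log_mul_tiltedMoment (P := P) hX hC le_rfl s).1
  have i1 := integrable_log_mul_tiltedMoment (P := P) hX hC (k := 1) (by norm_num) s
  have iF := integrable_overlap_integrand hX hX2 s
  rw [overlap, ← integral_const_mul, ← integral_const_mul,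
    ← integral_add (iF.const_mul _) (i2.const_mul _)]
  refine integral_id_mul_stdGauss (fun z => ?_) i1.1 i1.2 ((iF.const_mul _).add (i2.const_mul _))
  have hpos := tiltedMoment_zero_pos hX hX2 s z
  have h := (((hasDerivAt_tiltedMoment_right (P := P) hX hC 0 s z).log hpos.ne').add_const 1).mul
    (hasDerivAt_tiltedMoment_right (P := P) hX hC 1 s z)
  refine h.congr_deriv ?_
  simp only [zero_add, one_add_one_eq_two]
  ring

/-- The derivative in `s` of the relative-entropy form of the free energy. -/
lemma hasDerivAt_integral_mul_log (hX : Measurable X) (hC : ∀ x, |X x| ≤ C) (s : ℝ) :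
    HasDerivAt (fun s => ∫ z, Real.log (tiltedMoment P X 0 s z) * tiltedMoment P X 0 s z ∂stdGauss)
      (s * overlap P X s) s := by
  have hX2 := integrable_sq_of_bounded (P := P) hX hC
  have hC0 : 0 ≤ C := (abs_nonneg _).trans (hC 0)
  set S := |s| + 1 with hS
  have i0 := (integral_tiltedMoment hX hX2 (k := 0) (by norm_num) s).1
  have il := (integrable_log_mul_tiltedMoment (P := P) hX hC (k := 0) (by norm_num) s).1
  have i1 := (integrable_log_mul_tiltedMoment (P := P) hX hC (k := 1) (by norm_num) s).2
  have i2 := (integrable_log_mul_tiltedMoment (P := P) hX hC (k := 2) (by norm_num) s).1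
  have h := hasDerivAt_integral_of_dominated_loc_of_deriv_le (μ := stdGauss) (x₀ := s)
    (F := fun s z => Real.log (tiltedMoment P X 0 s z) * tiltedMoment P X 0 s z)
    (F' := fun s z => z * ((Real.log (tiltedMoment P X 0 s z) + 1) * tiltedMoment P X 1 s z) -
      s * ((Real.log (tiltedMoment P X 0 s z) + 1) * tiltedMoment P X 2 s z))
    (bound := fun z => ((S ^ 2 * C ^ 2 + 2) * (C + S * C ^ 2)) * exp ((S * C + 2) * |z|))
    (Metric.ball_mem_nhds s one_pos) (Eventually.of_forall fun t =>
      ((continuous_log_tiltedMoment hX hX2 t).mul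
        (continuous_tiltedMoment_right hX hX2 (by norm_num) t)).aestronglyMeasurable)
    ((il.sub i0).congr (ae_of_all _ fun z => by simp; ring))
    (i1.sub (i2.const_mul _)).aestronglyMeasurable (ae_of_all _ fun z t ht => ?_)
    ((integrable_exp_mul_abs_stdGauss _).const_mul _) (ae_of_all _ fun z t _ => ?_)
  · refine h.2.congr_deriv ?_
    rw [integral_sub i1 (i2.const_mul _), integral_mul_log_tiltedMoment hX hC, integral_const_mul]
    ring
  · have ht' : |t| ≤ S := by
      rw [Metric.mem_ball, dist_eq] at ht
      have := abs_add_le s (t - s)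
      rw [add_sub_cancel] at this
      linarith
    have hS0 : 0 ≤ S := (abs_nonneg t).trans ht'
    have e : exp (|t| * C * |z|) ≤ exp (S * C * |z|) := by gcongr
    have b0 := abs_log_tiltedMoment_add_one_le (P := P) hX hC ht' z
    have b1 := (abs_tiltedMoment_le (P := P) hC 1 t z).trans
      (mul_le_mul_of_nonneg_left e (by positivity))
    have b2 := (abs_tiltedMoment_le (P := P) hC 2 t z).trans
      (mul_le_mul_of_nonneg_left e (by positivity))
    have bz : |z| ≤ exp |z| := (le_add_of_nonneg_right zero_le_one).trans (add_one_le_exp |z|)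
    have hone : 1 ≤ exp |z| := one_le_exp (abs_nonneg z)
    have bb : |z * tiltedMoment P X 1 t z - t * tiltedMoment P X 2 t z| ≤
        (C + S * C ^ 2) * (exp |z| * exp (S * C * |z|)) := by
      refine (abs_sub _ _).trans ?_
      rw [abs_mul, abs_mul]
      have h1 : |z| * |tiltedMoment P X 1 t z| ≤ exp |z| * (C ^ 1 * exp (S * C * |z|)) := by
        gcongr
      have h2 : |t| * |tiltedMoment P X 2 t z| ≤ S * (C ^ 2 * exp (S * C * |z|)) := by
        gcongr
      have h3 : S * (C ^ 2 * exp (S * C * |z|)) ≤ S * (C ^ 2 * exp (S * C * |z|)) * exp |z| :=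
        le_mul_of_one_le_right (by positivity) hone
      linarith
    rw [show z * ((Real.log (tiltedMoment P X 0 t z) + 1) * tiltedMoment P X 1 t z) -
      t * ((Real.log (tiltedMoment P X 0 t z) + 1) * tiltedMoment P X 2 t z) =
      (Real.log (tiltedMoment P X 0 t z) + 1) *
        (z * tiltedMoment P X 1 t z - t * tiltedMoment P X 2 t z) by ring, norm_mul, norm_eq_abs,
      norm_eq_abs]
    refine (mul_le_mul b0 bb (abs_nonneg _) (by positivity)).trans (le_of_eq ?_)
    rw [show (S * C + 2) * |z| = |z| + |z| + S * C * |z| by ring, exp_add, exp_add]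
    ring
  · have hpos := tiltedMoment_zero_pos hX hX2 t z
    have hd := hasDerivAt_tiltedMoment_left (P := P) hX hC 0 t z
    refine ((hd.log hpos.ne').mul hd).congr_deriv ?_
    simp only [zero_add]
    field_simp
    ring

lemma integral_add_const_stdGauss (h : ℝ → ℝ) (c : ℝ) :
    ∫ z, h (z + c) ∂stdGauss = ∫ z, h z * exp (c * z - c ^ 2 / 2) ∂stdGauss := by
  rw [integral_stdGauss, integral_stdGauss,
    ← integral_add_right_eq_self (fun z => gaussianPDFReal 0 1 z * (h z * _)) c]
  congr 1
  funext z
  have : gaussianPDFReal 0 1 z =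
      gaussianPDFReal 0 1 (z + c) * exp (c * (z + c) - c ^ 2 / 2) := by
    rw [gaussianPDFReal, gaussianPDFReal, mul_assoc _ (exp _), ← exp_add]
    congr 2
    simp
    ring
  rw [this]
  ring

/-- The free energy of the channel `s X + Z`, as a function of the amplitude `s`. -/
def freeEnergy (P : Measure ℝ) (X : ℝ → ℝ) (s : ℝ) : ℝ :=
  ∫ x, ∫ z, Real.log (tiltedMoment P X 0 s (z + s * X x)) ∂stdGauss ∂P

lemma freeEnergy_eq_of_bounded (hX : Measurable X) (hC : ∀ x, |X x| ≤ C) (s : ℝ) :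
    freeEnergy P X s =
      ∫ z, Real.log (tiltedMoment P X 0 s z) * tiltedMoment P X 0 s z ∂stdGauss := by
  have hX2 := integrable_sq_of_bounded (P := P) hX hC
  have hL := continuous_log_tiltedMoment hX hX2 s
  have hLm := hL.measurable
  have hM : 0 ≤ ∫ x, X x ^ 2 ∂P := integral_nonneg fun x => sq_nonneg _
  set M := ∫ x, X x ^ 2 ∂P
  have hint : Integrable (Function.uncurry fun x z => Real.log (tiltedMoment P X 0 s z) *
      exp (s * z * X x - s ^ 2 / 2 * X x ^ 2)) (P.prod stdGauss) := by
    have hb := ((integrable_exp_mul_abs_stdGauss (1 + |s| * C)).const_mul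
      (1 + s ^ 2 * M)).comp_snd P
    refine hb.mono' ?_ (ae_of_all _ fun p => ?_)
    · refine ((hLm.comp measurable_snd).mul ?_).aestronglyMeasurable
      fun_prop
    · obtain ⟨x, z⟩ := p
      simp only [Function.uncurry]
      have h1 := abs_log_tiltedMoment_le hX hX2 s z
      have h2 := abs_pow_mul_tilt_le (hC x) 0 s z
      simp only [pow_zero, one_mul] at h2
      have h3 := sq_div_two_le_exp_abs z
      have h4 : s ^ 2 * M ≤ s ^ 2 * M * exp |z| :=
        le_mul_of_one_le_right (by positivity) (one_le_exp (abs_nonneg z))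
      rw [norm_mul, norm_eq_abs, norm_eq_abs, add_mul 1 (|s| * C), exp_add, one_mul, ← mul_assoc]
      refine mul_le_mul ?_ h2 (abs_nonneg _) (by positivity)
      linarith
  have hc : ∀ x, ∫ z, Real.log (tiltedMoment P X 0 s (z + s * X x)) ∂stdGauss =
      ∫ z, Real.log (tiltedMoment P X 0 s z) *
        exp (s * z * X x - s ^ 2 / 2 * X x ^ 2) ∂stdGauss := fun x => by
    rw [integral_add_const_stdGauss (fun z => Real.log (tiltedMoment P X 0 s z))]
    congr 1; funext z; congr 2; ring
  simp only [freeEnergy, hc]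
  rw [integral_integral_swap hint]
  congr 1; funext z
  rw [integral_const_mul]
  simp [tiltedMoment]

lemma hasDerivAt_freeEnergy_of_bounded (hX : Measurable X) (hC : ∀ x, |X x| ≤ C) (s : ℝ) :
    HasDerivAt (freeEnergy P X) (s * overlap P X s) s := by
  rw [show freeEnergy P X = _ from funext fun s => freeEnergy_eq_of_bounded hX hC s]
  exact hasDerivAt_integral_mul_log hX hC s

end Bounded

/-! ### Removing the boundedness assumption -/

section Truncation

variable {P : Measure ℝ} [IsProbabilityMeasure P] {X : ℝ → ℝ}

lemma integrable_sq_stdGauss : Integrable (fun z : ℝ => z ^ 2) stdGauss :=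
  (memLp_id_gaussianReal' (μ := 0) (v := 1) 2 (by norm_num)).integrable_sq

lemma tendsto_freeEnergy (hX : Measurable X) (hX2 : Integrable (fun x => X x ^ 2) P)
    {Y : ℕ → ℝ → ℝ} (hY : ∀ i, Measurable (Y i)) (hYX : ∀ i x, |Y i x| ≤ |X x|)
    (hlim : ∀ x, Tendsto (fun i => Y i x) atTop (nhds (X x))) (s : ℝ) :
    Tendsto (fun i => freeEnergy P (Y i) s) atTop (nhds (freeEnergy P X s)) := by
  have hY2 : ∀ i, Integrable (fun x => Y i x ^ 2) P := fun i =>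
    integrable_sq_of_abs_le hX2 (hY i) (hYX i)
  set M := ∫ x, X x ^ 2 ∂P
  have hM : ∀ i, ∫ x, Y i x ^ 2 ∂P ≤ M := fun i =>
    integral_mono (hY2 i) hX2 fun x => sq_le_sq.2 (hYX i x)
  have hb : ∀ i x z, ‖Real.log (tiltedMoment P (Y i) 0 s (z + s * Y i x))‖ ≤
      z ^ 2 + (s ^ 2 * X x ^ 2 + s ^ 2 * M) := fun i x z => by
    have h1 := abs_log_tiltedMoment_le (hY i) (hY2 i) s (z + s * Y i x)
    have h2 : s ^ 2 * Y i x ^ 2 ≤ s ^ 2 * X x ^ 2 :=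
      mul_le_mul_of_nonneg_left (sq_le_sq.2 (hYX i x)) (sq_nonneg s)
    have h3 := mul_le_mul_of_nonneg_left (hM i) (sq_nonneg s)
    rw [norm_eq_abs]
    nlinarith [sq_nonneg (z - s * Y i x)]
  have hbz : ∀ x, Integrable (fun z => z ^ 2 + (s ^ 2 * X x ^ 2 + s ^ 2 * M)) stdGauss := fun x =>
    integrable_sq_stdGauss.add (integrable_const _)
  refine tendsto_integral_of_dominated_convergence
    (fun x => ∫ z, z ^ 2 ∂stdGauss + (s ^ 2 * X x ^ 2 + s ^ 2 * M)) (fun i => ?_)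
    ((integrable_const _).add ((hX2.const_mul _).add (integrable_const _)))
    (fun i => ae_of_all _ fun x => ?_) (ae_of_all _ fun x => ?_)
  · have hm := (continuous_log_tiltedMoment (hY i) (hY2 i) s).measurable
    have : StronglyMeasurable (Function.uncurry fun x z =>
        Real.log (tiltedMoment P (Y i) 0 s (z + s * Y i x))) := by
      have hYi := hY i
      have h2 : Measurable fun p : ℝ × ℝ => p.2 + s * Y i p.1 := by fun_prop
      exact (hm.comp h2).stronglyMeasurable
    exact this.integral_prod_right.aestronglyMeasurable
  · have := norm_integral_le_of_norm_le (hbz x) (ae_of_all _ (hb i x))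
    rw [integral_add integrable_sq_stdGauss (integrable_const _)] at this
    simpa using this
  · refine tendsto_integral_of_dominated_convergence _ (fun i => ?_) (hbz x)
      (fun i => ae_of_all _ (hb i x)) (ae_of_all _ fun z => ?_)
    · exact ((continuous_log_tiltedMoment (hY i) (hY2 i) s).comp
        (continuous_id.add continuous_const)).aestronglyMeasurable
    · exact (tendsto_tiltedMoment hX hX2 (by norm_num) hY hYX hlim tendsto_const_nhds
        (tendsto_const_nhds.add ((hlim x).const_mul s))).log
          (tiltedMoment_zero_pos hX hX2 s _).ne'

lemma freeEnergy_sub (hX : Measurable X) (hX2 : Integrable (fun x => X x ^ 2) P) (a b : ℝ) :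
    freeEnergy P X b - freeEnergy P X a = ∫ s in a..b, s * overlap P X s := by
  set Y : ℕ → ℝ → ℝ := fun n x => max (-(n : ℝ)) (min n (X x)) with hYdef
  have hY : ∀ i, Measurable (Y i) := fun i => measurable_const.max (measurable_const.min hX)
  have hYC : ∀ i x, |Y i x| ≤ (i : ℝ) := fun i x =>
    abs_le.2 ⟨le_max_left _ _, max_le (by linarith [i.cast_nonneg (α := ℝ)]) (min_le_left _ _)⟩
  have hYX : ∀ i x, |Y i x| ≤ |X x| := fun i x => by
    have hi := i.cast_nonneg (α := ℝ)
    have := neg_abs_le (X x)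
    have := le_abs_self (X x)
    have := abs_nonneg (X x)
    refine abs_le.2 ⟨le_max_of_le_right (le_min ?_ ?_), max_le ?_ ((min_le_right _ _).trans ?_)⟩ <;>
      linarith
  have hlim : ∀ x, Tendsto (fun i => Y i x) atTop (nhds (X x)) := fun x => by
    refine tendsto_const_nhds.congr' ?_
    filter_upwards [eventually_ge_atTop ⌈|X x|⌉₊] with n hn
    have hn' : |X x| ≤ n := Nat.ceil_le.1 hn
    rw [abs_le] at hn'
    rw [hYdef]
    simp only
    rw [min_eq_right hn'.2, max_eq_right hn'.1]
  have hY2 : ∀ i, Integrable (fun x => Y i x ^ 2) P := fun i =>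
    integrable_sq_of_abs_le hX2 (hY i) (hYX i)
  have hcont : ∀ i, Continuous fun s => s * overlap P (Y i) s := fun i =>
    continuous_id.mul (continuous_overlap (hY i) (hY2 i))
  have hsub : ∀ i, freeEnergy P (Y i) b - freeEnergy P (Y i) a =
      ∫ s in a..b, s * overlap P (Y i) s := fun i =>
    (intervalIntegral.integral_eq_sub_of_hasDerivAt
      (fun s _ => hasDerivAt_freeEnergy_of_bounded (hY i) (hYC i) s)
      ((hcont i).intervalIntegrable a b)).symm
  have h1 := (tendsto_freeEnergy hX hX2 hY hYX hlim b).sub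
    (tendsto_freeEnergy hX hX2 hY hYX hlim a)
  simp only [hsub] at h1
  refine tendsto_nhds_unique h1 ?_
  refine intervalIntegral.tendsto_integral_filter_of_dominated_convergence
    (fun s => |s| * ∫ x, X x ^ 2 ∂P) (Eventually.of_forall fun i =>
      (hcont i).aestronglyMeasurable) (Eventually.of_forall fun i => ae_of_all _ fun s _ => ?_)
    ((continuous_abs.mul continuous_const).intervalIntegrable a b)
    (ae_of_all _ fun s _ => (tendsto_overlap hX hX2 hY hYX hlim tendsto_const_nhds).const_mul s)
  rw [norm_mul, norm_eq_abs, norm_of_nonneg (overlap_nonneg (hY i) (hY2 i) s)]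
  exact mul_le_mul_of_nonneg_left ((overlap_le (hY i) (hY2 i) s).trans
    (integral_mono (hY2 i) hX2 fun x => sq_le_sq.2 (hYX i x))) (abs_nonneg s)

/-- The derivative of the free energy with respect to the amplitude. -/
lemma hasDerivAt_freeEnergy (hX : Measurable X) (hX2 : Integrable (fun x => X x ^ 2) P) (s : ℝ) :
    HasDerivAt (freeEnergy P X) (s * overlap P X s) s := by
  have h : freeEnergy P X = fun t => freeEnergy P X 0 + ∫ u in (0 : ℝ)..t, u * overlap P X u :=
    funext fun t => by rw [← freeEnergy_sub hX hX2]; ring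
  rw [h]
  exact ((continuous_id.mul (continuous_overlap hX hX2)).integral_hasStrictDerivAt 0
    s).hasDerivAt.const_add _

end Truncation

/-! ### The scalar free energy and state evolution -/

lemma scalarFE_eq_freeEnergy (P : Measure ℝ) {γ : ℝ} (hγ : 0 ≤ γ) :
    scalarFE P γ = freeEnergy P id √γ := by
  unfold scalarFE freeEnergy tiltedMoment
  congr 1; funext x₀; congr 1; funext z; congr 2; funext x
  rw [pow_zero, one_mul]
  congr 1
  simp only [id, sq_sqrt hγ]
  linear_combination (-(x * x₀)) * sq_sqrt hγ

section ScalarFE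

variable {P : Measure ℝ} [IsProbabilityMeasure P]

lemma hasDerivAt_scalarFE (hP : Integrable (fun x => x ^ 2) P) {γ : ℝ} (hγ : 0 < γ) :
    HasDerivAt (scalarFE P) (overlap P id √γ / 2) γ := by
  have h := (hasDerivAt_freeEnergy (P := P) measurable_id hP √γ).comp γ (hasDerivAt_sqrt hγ.ne')
  have h' : HasDerivAt (freeEnergy P id ∘ sqrt) (overlap P id √γ / 2) γ := by
    refine h.congr_deriv ?_
    have := sqrt_pos.2 hγ
    field_simp
  refine h'.congr_of_eventuallyEq ?_
  filter_upwards [lt_mem_nhds hγ] with t ht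
  exact scalarFE_eq_freeEnergy P ht.le

lemma hasDerivWithinAt_scalarFE_zero (hP : Integrable (fun x => x ^ 2) P) :
    HasDerivWithinAt (scalarFE P) (overlap P id √0 / 2) (Set.Ici 0) 0 := by
  refine hasDerivWithinAt_Ici_of_tendsto_deriv (s := Set.Ioi 0)
    (fun γ hγ => (hasDerivAt_scalarFE hP hγ).differentiableAt.differentiableWithinAt) ?_
    self_mem_nhdsWithin ?_
  · have hc : Continuous fun γ => freeEnergy P id √γ :=
      (continuous_iff_continuousAt.2 fun s =>
        (hasDerivAt_freeEnergy (P := P) measurable_id hP s).continuousAt).comp continuous_sqrt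
    exact hc.continuousWithinAt.congr (fun γ hγ => scalarFE_eq_freeEnergy P (le_of_lt hγ))
      (scalarFE_eq_freeEnergy P le_rfl)
  · have hc : Continuous fun γ => overlap P id √γ / 2 :=
      ((continuous_overlap (P := P) measurable_id hP).comp continuous_sqrt).div_const 2
    refine (hc.continuousWithinAt (s := Set.Ioi 0) (x := 0)).congr' ?_
    filter_upwards [self_mem_nhdsWithin] with γ hγ
    exact (hasDerivAt_scalarFE hP hγ).deriv.symm

/-- At `0` the two-sided derivative is either the right derivative or the default value. -/
lemma deriv_scalarFE_zero (hP : Integrable (fun x => x ^ 2) P) :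
    deriv (scalarFE P) 0 = 0 ∨ deriv (scalarFE P) 0 = overlap P id √0 / 2 := by
  by_cases h : DifferentiableAt ℝ (scalarFE P) 0
  · exact Or.inr ((uniqueDiffWithinAt_Ici 0).eq_deriv _ h.hasDerivAt.hasDerivWithinAt
      (hasDerivWithinAt_scalarFE_zero hP))
  · exact Or.inl (deriv_zero_of_not_differentiableAt h)

end ScalarFE

/-- Iterates of a continuous monotone map with bounded range converge to a fixed point. -/
lemma exists_tendsto_fixedPoint_of_monotone {f : ℝ → ℝ} (hf : Continuous f) (hmono : Monotone f)
    {m M : ℝ} (hm : ∀ x, m ≤ f x) (hM : ∀ x, f x ≤ M) {q : ℕ → ℝ}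
    (hq : ∀ t, q (t + 1) = f (q t)) :
    ∃ L, Tendsto q atTop (nhds L) ∧ L = f L := by
  obtain ⟨L, hL⟩ : ∃ L, Tendsto (fun t => q (t + 1)) atTop (nhds L) := by
    rcases le_total (q 0) (q 1) with h | h
    · have h' : Monotone q := monotone_nat_of_le_succ fun n => by
        induction n with
        | zero => exact h
        | succ n ih => rw [hq n, hq (n + 1)]; exact hmono ih
      exact ⟨_, tendsto_atTop_ciSup (fun a b hab => h' (by omega))
        ⟨M, by rintro _ ⟨t, rfl⟩; simpa only [hq] using hM _⟩⟩
    · have h' : Antitone q := antitone_nat_of_succ_le fun n => by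
        induction n with
        | zero => exact h
        | succ n ih => rw [hq n, hq (n + 1)]; exact hmono ih
      exact ⟨_, tendsto_atTop_ciInf (fun a b hab => h' (by omega))
        ⟨m, by rintro _ ⟨t, rfl⟩; simpa only [hq] using hm _⟩⟩
  have hL' : Tendsto q atTop (nhds L) := (tendsto_add_atTop_iff_nat 1).1 hL
  refine ⟨L, hL', tendsto_nhds_unique hL ?_⟩
  simp only [hq]
  exact (hf.tendsto L).comp hL'

/-- **State evolution converges to a fixed point of `q ↦ 2 ψ′_{P0}(λ q)`.** -/
theorem state_evolution_converges (P0 : Measure ℝ) [IsProbabilityMeasure P0]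
    (hmom : Integrable (fun x => x ^ 2) P0) (hunit : ∫ x, x ^ 2 ∂P0 = 1)
    (lam : ℝ) (hlam : 0 < lam) (q : ℕ → ℝ)
    (hq0 : q 0 = max 0 (1 - lam⁻¹))
    (hrec : ∀ t, q (t + 1) = 2 * deriv (scalarFE P0) (lam * q t)) :
    ∃ qinf : ℝ, 0 ≤ qinf ∧ Tendsto q atTop (nhds qinf) ∧
      qinf = 2 * deriv (scalarFE P0) (lam * qinf) := by
  have hc : Continuous fun x => overlap P0 id √(lam * x) :=
    (continuous_overlap (P := P0) measurable_id hmom).comp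
      (continuous_sqrt.comp (continuous_const.mul continuous_id))
  have hmono : Monotone fun x => overlap P0 id √(lam * x) := fun x y hxy =>
    overlap_mono (P := P0) measurable_id hmom (sqrt_nonneg _)
      (sqrt_le_sqrt (mul_le_mul_of_nonneg_left hxy hlam.le))
  have hnn : ∀ x, 0 ≤ overlap P0 id √(lam * x) := fun x =>
    overlap_nonneg (P := P0) measurable_id hmom _
  have hle : ∀ x, overlap P0 id √(lam * x) ≤ 1 := fun x =>
    (overlap_le (P := P0) measurable_id hmom _).trans_eq hunit
  have hderiv : ∀ x, 0 < x → 2 * deriv (scalarFE P0) (lam * x) = overlap P0 id √(lam * x) :=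
    fun x hx => by rw [(hasDerivAt_scalarFE hmom (mul_pos hlam hx)).deriv]; ring
  have hq0nn : 0 ≤ q 0 := hq0 ▸ le_max_left _ _
  by_cases hd : 2 * deriv (scalarFE P0) (lam * 0) = overlap P0 id √(lam * 0)
  · have hderiv' : ∀ x, 0 ≤ x → 2 * deriv (scalarFE P0) (lam * x) = overlap P0 id √(lam * x) :=
      fun x hx => hx.eq_or_lt.elim (fun h => h ▸ hd) (hderiv x)
    have hqnn : ∀ t, 0 ≤ q t := fun t => by
      induction t with
      | zero => exact hq0nn
      | succ t ih => rw [hrec, hderiv' _ ih]; exact hnn _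
    obtain ⟨L, hL, hfix⟩ := exists_tendsto_fixedPoint_of_monotone hc hmono hnn hle
      fun t => (hrec t).trans (hderiv' _ (hqnn t))
    have hL0 : 0 ≤ L := hfix ▸ hnn L
    exact ⟨L, hL0, hL, hfix.trans (hderiv' L hL0).symm⟩
  · have hd0 : 2 * deriv (scalarFE P0) (lam * 0) = 0 := by
      rcases deriv_scalarFE_zero hmom with h | h
      · rw [mul_zero, h, mul_zero]
      · exact absurd (by rw [mul_zero, h]; ring) hd
    rcases hq0nn.eq_or_lt with h0 | h0
    · have hq : ∀ t, q t = 0 := fun t => by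
        induction t with
        | zero => exact h0.symm
        | succ t ih => rw [hrec, ih, hd0]
      exact ⟨0, le_rfl, by simp [funext hq], hd0.symm⟩
    · have hpos : 0 < overlap P0 id √(lam * 0) :=
        (hnn 0).lt_of_ne fun h => hd (hd0.trans h)
      have hfpos : ∀ x, 0 ≤ x → 0 < overlap P0 id √(lam * x) := fun x hx =>
        hpos.trans_le (hmono hx)
      have hqpos : ∀ t, 0 < q t := fun t => by
        induction t with
        | zero => exact h0
        | succ t ih => rw [hrec, hderiv _ ih]; exact hfpos _ ih.le
      obtain ⟨L, hL, hfix⟩ := exists_tendsto_fixedPoint_of_monotone hc hmono hnn hle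
        fun t => (hrec t).trans (hderiv _ (hqpos t))
      have hL0 : 0 ≤ L := hfix ▸ hnn L
      exact ⟨L, hL0, hL, hfix.trans (hderiv L (hfix ▸ hfpos L hL0)).symm⟩

end
end
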